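/- arXiv:gr-qc/0004008 — 2 statements merged into one kernel-verified Lean document; each statement's English description precedes it below -/
import Mathlib

section
/- (Derivative of a pseudo-function times the Dirac pseudo-function.) Let F and G be smooth on a punctured neighbourhood of y ∈ ℝ³, and assume that F, G, ∂_iF and ∂_iG all admit singular expansions at y. Then the Hadamard parties finies at y satisfy (F ∂_iG)_y = −( (∂_iF − 3 nⁱ r^{−1} F) G )_y, i.e. (F ∂_iG)_y = −( r³ ∂_i(r^{−3} F) · G )_y. -/
open MeasureTheory Filter Topology Real Asymptotics

noncomputable section

abbrev E3 : Type := EuclideanSpace ℝ (Fin 3)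
abbrev S2 : Type := Metric.sphere (0 : E3) 1

/-- The surface measure `dΩ` on the unit sphere `S²` (total mass `4π`). -/
def dOmega : Measure S2 := (volume : Measure E3).toSphere

/-- A function on the unit sphere is smooth iff it is the restriction of
a smooth function on `ℝ³`. -/
def SmoothSphereFn (f : S2 → ℝ) : Prop :=
  ∃ g : E3 → ℝ, ContDiff ℝ (⊤ : ℕ∞) g ∧ ∀ n : S2, g (n : E3) = f n

/-- `F` admits a power-like singular expansion at `y` with coefficients `c`:
the family of exponents (the `a`'s with `c a ≠ 0`) is bounded below, with only
finitely many exponents below any given bound, the coefficients are smooth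
functions on the sphere, and for every `N`, `F(y + r n) = Σ_{a ≤ N} r^a (c a)(n)
+ o(r^N)` as `r → 0⁺`, uniformly in `n ∈ S²`. -/
structure HasSingExpansion (y : E3) (F : E3 → ℝ) (c : ℝ → S2 → ℝ) : Prop where
  smooth_coeffs : ∀ a : ℝ, SmoothSphereFn (c a)
  bddBelow : ∃ a₀ : ℝ, ∀ a : ℝ, a < a₀ → c a = 0
  finite_exponents : ∀ N : ℝ, {a : ℝ | a ≤ N ∧ c a ≠ 0}.Finite
  expansion : ∀ N : ℕ, ∀ ε > 0, ∃ δ > 0, ∀ r : ℝ, 0 < r → r < δ → ∀ n : S2,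
    |F (y + r • (n : E3)) - ∑ᶠ (a : ℝ) (_ : a ≤ (N : ℝ)), r ^ a * c a n| ≤ ε * r ^ (N : ℝ)

/-- The exponents of the singular expansion are integers. -/
def IntegerExponents (c : ℝ → S2 → ℝ) : Prop :=
  ∀ a : ℝ, c a ≠ 0 → ∃ k : ℤ, a = (k : ℝ)

/-- The Hadamard partie finie at the singular point, `(F)_y = (1/4π) ∫_{S²} f₀ dΩ`,
expressed in terms of the expansion coefficients `c` of `F`. -/
def pfAt (c : ℝ → S2 → ℝ) : ℝ :=
  (4 * π)⁻¹ * ∫ n : S2, c 0 n ∂dOmega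

/-- `F` is smooth on a punctured neighbourhood of `y`. -/
def SmoothNearPunctured (y : E3) (F : E3 → ℝ) : Prop :=
  ∃ U ∈ 𝓝 y, ContDiffOn ℝ (⊤ : ℕ∞) F (U \ {y})

/-- The quantity whose limit as `s → 0⁺` defines the Hadamard partie finie
`Pf_{s₁,s₂} ∫ F d³x`: the integral over `ℝ³` minus two balls of radius `s`,
plus the divergent subtractions built from the expansion coefficients `c` at `y₁`
and `d` at `y₂`. -/
def pfApprox (y₁ y₂ : E3) (s₁ s₂ : ℝ) (F : E3 → ℝ) (c d : ℝ → S2 → ℝ) (s : ℝ) : ℝ :=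
  (∫ x in (Metric.closedBall y₁ s ∪ Metric.closedBall y₂ s)ᶜ, F x)
    + (∑ᶠ (a : ℝ) (_ : a < -3), s ^ (a + 3) / (a + 3) * ∫ n : S2, c a n ∂dOmega)
    + Real.log (s / s₁) * (∫ n : S2, c (-3) n ∂dOmega)
    + (∑ᶠ (b : ℝ) (_ : b < -3), s ^ (b + 3) / (b + 3) * ∫ n : S2, d b n ∂dOmega)
    + Real.log (s / s₂) * (∫ n : S2, d (-3) n ∂dOmega)

/-- `Pf_{s₁,s₂} ∫ F d³x` exists and equals `L`. -/
def HasPfIntegral (y₁ y₂ : E3) (s₁ s₂ : ℝ) (F : E3 → ℝ) (c d : ℝ → S2 → ℝ) (L : ℝ) : Prop :=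
  Tendsto (pfApprox y₁ y₂ s₁ s₂ F c d) (𝓝[>] (0 : ℝ)) (𝓝 L)

/-- Membership in the class `𝓕`: smooth outside `{y₁, y₂}` and admitting singular
expansions at `y₁` (coefficients `c`) and `y₂` (coefficients `d`). -/
structure MemF (y₁ y₂ : E3) (F : E3 → ℝ) (c d : ℝ → S2 → ℝ) : Prop where
  smooth : ContDiffOn ℝ (⊤ : ℕ∞) F ({y₁, y₂}ᶜ : Set E3)
  exp₁ : HasSingExpansion y₁ F c
  exp₂ : HasSingExpansion y₂ F d

/-- The partial derivative `∂_i F` (as a plain function, defined outside the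
singularities via `fderiv`). -/
def pder (i : Fin 3) (F : E3 → ℝ) (x : E3) : ℝ :=
  fderiv ℝ F x (EuclideanSpace.single i 1)

/-! ### Algebra of singular expansions -/

def lf : Filter (ℝ × S2) := (𝓝[>] (0 : ℝ)) ×ˢ (⊤ : Filter S2)

lemma eventually_lf {P : ℝ × S2 → Prop} :
    (∀ᶠ x in lf, P x) ↔ ∃ δ > 0, ∀ r : ℝ, 0 < r → r < δ → ∀ n : S2, P (r, n) := by
  unfold lf
  rw [← Filter.principal_univ, Filter.eventually_prod_principal_iff]
  simp only [Set.mem_univ, forall_true_left]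
  rw [eventually_nhdsWithin_iff, Metric.eventually_nhds_iff]
  constructor
  · rintro ⟨δ, hδ, h⟩
    refine ⟨δ, hδ, fun r h0 h1 n => h (y := r) ?_ h0 n⟩
    rw [Real.dist_eq, sub_zero, abs_of_pos h0]; exact h1
  · rintro ⟨δ, hδ, h⟩
    refine ⟨δ, hδ, fun r h1 h0 n => h r h0 ?_ n⟩
    rw [Real.dist_eq, sub_zero] at h1
    exact (le_abs_self r).trans_lt h1

lemma pos_lf : ∀ᶠ x in lf, 0 < x.1 :=
  eventually_lf.2 ⟨1, one_pos, fun _ h _ _ => h⟩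

lemma expansion_iff (y : E3) (F : E3 → ℝ) (T : ℝ → S2 → ℝ) (N : ℝ) :
    (∀ ε > 0, ∃ δ > 0, ∀ r : ℝ, 0 < r → r < δ → ∀ n : S2,
      |F (y + r • (n : E3)) - T r n| ≤ ε * r ^ N) ↔
    (fun x : ℝ × S2 => F (y + x.1 • (x.2 : E3)) - T x.1 x.2) =o[lf] fun x => x.1 ^ N := by
  rw [isLittleO_iff]
  refine forall_congr' fun ε => forall_congr' fun _ => ?_
  rw [eventually_lf]
  refine exists_congr fun δ => and_congr_right fun _ => forall_congr' fun r =>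
    forall_congr' fun h0 => forall_congr' fun _ => forall_congr' fun n => ?_
  simp only [Real.norm_eq_abs]
  rw [abs_of_pos (Real.rpow_pos_of_pos h0 N)]

lemma finsum_eq_sum_aux (c : ℝ → S2 → ℝ) (n : S2) (r N : ℝ) (S : Finset ℝ)
    (h1 : ∀ a ∈ S, a ≤ N) (h2 : ∀ a ≤ N, c a ≠ 0 → a ∈ S) :
    ∑ᶠ (a : ℝ) (_ : a ≤ N), r ^ a * c a n = ∑ a ∈ S, r ^ a * c a n := by
  classical
  simp only [finsum_eq_if]
  rw [finsum_eq_sum_of_support_subset (s := S)]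
  · exact Finset.sum_congr rfl fun a ha => by rw [if_pos (h1 a ha)]
  · intro a ha
    rw [Function.mem_support] at ha
    by_cases haN : a ≤ N
    · rw [if_pos haN] at ha
      refine h2 a haN fun h => ha ?_
      rw [h]; simp
    · rw [if_neg haN] at ha; exact absurd rfl ha

lemma SmoothSphereFn.continuous {f : S2 → ℝ} (h : SmoothSphereFn f) : Continuous f := by
  obtain ⟨g, hg, hgf⟩ := h
  have : f = fun n : S2 => g n := by ext n; exact (hgf n).symm
  rw [this]
  exact hg.continuous.comp continuous_subtype_val

lemma SmoothSphereFn.bdd {f : S2 → ℝ} (h : SmoothSphereFn f) : ∃ C, ∀ n, |f n| ≤ C := by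
  obtain ⟨C, hC⟩ := isCompact_univ.exists_bound_of_continuousOn (h.continuous.continuousOn (s := Set.univ))
  exact ⟨C, fun n => hC n trivial⟩

lemma SmoothSphereFn.zero : SmoothSphereFn 0 := ⟨0, contDiff_const, fun _ => rfl⟩

lemma SmoothSphereFn.add {f g : S2 → ℝ} (hf : SmoothSphereFn f) (hg : SmoothSphereFn g) :
    SmoothSphereFn (f + g) := by
  obtain ⟨u, hu, huf⟩ := hf
  obtain ⟨v, hv, hvg⟩ := hg
  exact ⟨u + v, hu.add hv, fun n => by simp [huf, hvg]⟩

lemma SmoothSphereFn.mul {f g : S2 → ℝ} (hf : SmoothSphereFn f) (hg : SmoothSphereFn g) :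
    SmoothSphereFn (f * g) := by
  obtain ⟨u, hu, huf⟩ := hf
  obtain ⟨v, hv, hvg⟩ := hg
  exact ⟨u * v, hu.mul hv, fun n => by simp [huf, hvg]⟩

lemma SmoothSphereFn.sum {ι : Type} (s : Finset ι) (f : ι → S2 → ℝ)
    (hf : ∀ i, SmoothSphereFn (f i)) : SmoothSphereFn (∑ i ∈ s, f i) := by
  classical
  induction s using Finset.induction_on with
  | empty => simpa using SmoothSphereFn.zero
  | insert a s ha ih => rw [Finset.sum_insert ha]; exact (hf a).add ih

lemma rpow_isBigO {a b : ℝ} (h : b ≤ a) :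
    (fun x : ℝ × S2 => x.1 ^ a) =O[lf] fun x => x.1 ^ b := by
  refine IsBigO.of_bound 1 (eventually_lf.2 ⟨1, one_pos, fun r h0 h1 n => ?_⟩)
  simp only [Real.norm_eq_abs, one_mul]
  rw [abs_of_pos (Real.rpow_pos_of_pos h0 _), abs_of_pos (Real.rpow_pos_of_pos h0 _)]
  exact Real.rpow_le_rpow_of_exponent_ge h0 h1.le h

lemma rpow_isLittleO {a b : ℝ} (h : b < a) :
    (fun x : ℝ × S2 => x.1 ^ a) =o[lf] fun x => x.1 ^ b := by
  have h1 : Tendsto (fun r : ℝ => r ^ (a - b)) (𝓝[>] 0) (𝓝 0) := by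
    have : ContinuousAt (fun r : ℝ => r ^ (a - b)) 0 :=
      Real.continuousAt_rpow_const _ _ (Or.inr (by linarith))
    have h2 := this.tendsto.mono_left (nhdsWithin_le_nhds (s := Set.Ioi 0))
    rwa [Real.zero_rpow (by linarith)] at h2
  have h2 : Tendsto (fun x : ℝ × S2 => x.1 ^ (a - b)) lf (𝓝 0) := h1.comp tendsto_fst
  refine isLittleO_of_tendsto' ?_ (h2.congr' ?_)
  · filter_upwards [pos_lf] with x hx h0
    exact absurd h0 (Real.rpow_pos_of_pos hx _).ne'
  · filter_upwards [pos_lf] with x hx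
    rw [Real.rpow_sub hx]

lemma bdd_isBigO {f : S2 → ℝ} (h : ∃ C, ∀ n, |f n| ≤ C) :
    (fun x : ℝ × S2 => f x.2) =O[lf] fun _ => (1 : ℝ) := by
  obtain ⟨C, hC⟩ := h
  exact IsBigO.of_bound C (Eventually.of_forall fun x => by simpa using hC x.2)

lemma term_isBigO {f : S2 → ℝ} (h : ∃ C, ∀ n, |f n| ≤ C) {a b : ℝ} (hab : b ≤ a) :
    (fun x : ℝ × S2 => x.1 ^ a * f x.2) =O[lf] fun x => x.1 ^ b := by
  simpa using (rpow_isBigO hab).mul (bdd_isBigO h)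

lemma term_isLittleO {f : S2 → ℝ} (h : ∃ C, ∀ n, |f n| ≤ C) {a b : ℝ} (hab : b < a) :
    (fun x : ℝ × S2 => x.1 ^ a * f x.2) =o[lf] fun x => x.1 ^ b := by
  simpa using (rpow_isLittleO hab).mul_isBigO (bdd_isBigO h)

/-- Truncated expansion with respect to an explicit finset. -/
lemma HasSingExpansion.trunc {y : E3} {F : E3 → ℝ} {c : ℝ → S2 → ℝ}
    (h : HasSingExpansion y F c) (N : ℕ) (S : Finset ℝ)
    (h1 : ∀ a ∈ S, a ≤ (N : ℝ)) (h2 : ∀ a ≤ (N : ℝ), c a ≠ 0 → a ∈ S) :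
    (fun x : ℝ × S2 => F (y + x.1 • (x.2 : E3)) - ∑ a ∈ S, x.1 ^ a * c a x.2)
      =o[lf] fun x => x.1 ^ (N : ℝ) := by
  have := (expansion_iff y F (fun r n => ∑ᶠ (a : ℝ) (_ : a ≤ (N : ℝ)), r ^ a * c a n) N).1
    (h.expansion N)
  refine this.congr_left fun x => ?_
  rw [finsum_eq_sum_aux c x.2 x.1 N S h1 h2]

lemma expansion_of (y : E3) (F : E3 → ℝ) {c : ℝ → S2 → ℝ} (N : ℕ)
    (S : Finset ℝ) (c' : ℝ → S2 → ℝ)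
    (h1 : ∀ a ∈ S, a ≤ (N : ℝ) → c' a = c a) (h2 : ∀ a ≤ (N : ℝ), c a ≠ 0 → a ∈ S)
    (hb : ∀ a, ∃ C, ∀ n, |c' a n| ≤ C)
    (h : (fun x : ℝ × S2 => F (y + x.1 • (x.2 : E3)) - ∑ a ∈ S, x.1 ^ a * c' a x.2)
      =o[lf] fun x => x.1 ^ (N : ℝ)) :
    ∀ ε > 0, ∃ δ > 0, ∀ r : ℝ, 0 < r → r < δ → ∀ n : S2,
    |F (y + r • (n : E3)) - ∑ᶠ (a : ℝ) (_ : a ≤ (N : ℝ)), r ^ a * c a n| ≤ ε * r ^ (N : ℝ) := by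
  classical
  refine (expansion_iff y F (fun r n => ∑ᶠ (a : ℝ) (_ : a ≤ (N : ℝ)), r ^ a * c a n) N).2 ?_
  have h3 : (fun x : ℝ × S2 => ∑ a ∈ S.filter (fun a => ¬ a ≤ (N : ℝ)), x.1 ^ a * c' a x.2)
      =o[lf] fun x => x.1 ^ (N : ℝ) := by
    refine IsLittleO.fun_sum fun a ha => term_isLittleO (hb a) ?_
    exact not_le.1 (Finset.mem_filter.1 ha).2
  refine (h.add h3).congr_left fun x => ?_
  rw [finsum_eq_sum_aux c x.2 x.1 N (S.filter (fun a => a ≤ (N : ℝ)))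
    (fun a ha => (Finset.mem_filter.1 ha).2)
    (fun a ha h => Finset.mem_filter.2 ⟨h2 a ha h, ha⟩),
    ← Finset.sum_filter_add_sum_filter_not S (fun a => a ≤ (N : ℝ))]
  have : ∑ a ∈ S.filter (fun a => a ≤ (N : ℝ)), x.1 ^ a * c' a x.2 =
      ∑ a ∈ S.filter (fun a => a ≤ (N : ℝ)), x.1 ^ a * c a x.2 :=
    Finset.sum_congr rfl fun a ha => by
      rw [h1 a (Finset.mem_filter.1 ha).1 (Finset.mem_filter.1 ha).2]
  rw [this]; ring

lemma HasSingExpansion.add {y : E3} {F G : E3 → ℝ} {c d : ℝ → S2 → ℝ}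
    (hF : HasSingExpansion y F c) (hG : HasSingExpansion y G d) :
    HasSingExpansion y (fun x => F x + G x) (fun a => c a + d a) where
  smooth_coeffs a := (hF.smooth_coeffs a).add (hG.smooth_coeffs a)
  bddBelow := by
    obtain ⟨a, ha⟩ := hF.bddBelow
    obtain ⟨b, hb⟩ := hG.bddBelow
    exact ⟨min a b, fun x hx => by
      rw [ha x (hx.trans_le (min_le_left _ _)), hb x (hx.trans_le (min_le_right _ _)), add_zero]⟩
  finite_exponents N := by
    refine ((hF.finite_exponents N).union (hG.finite_exponents N)).subset ?_
    rintro a ⟨ha, h⟩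
    by_cases hc : c a = 0
    · right; exact ⟨ha, fun hd => h (by simp [hc, hd])⟩
    · left; exact ⟨ha, hc⟩
  expansion N := by
    classical
    set S := (hF.finite_exponents N).toFinset ∪ (hG.finite_exponents N).toFinset with hS
    have hSN : ∀ a ∈ S, a ≤ (N : ℝ) := by
      intro a ha
      simp [hS] at ha
      tauto
    have e1 := hF.trunc N S hSN (fun a ha h => by simp [hS, ha, h])
    have e2 := hG.trunc N S hSN (fun a ha h => by simp [hS, ha, h])
    refine expansion_of y (fun x => F x + G x) N S (fun a => c a + d a) (fun _ _ _ => rfl) ?_ 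
      (fun a => ((hF.smooth_coeffs a).add (hG.smooth_coeffs a)).bdd) ?_
    · intro a ha h
      by_contra hn
      simp [hS, ha] at hn
      exact h (by rw [hn.1, hn.2, add_zero])
    · refine (e1.add e2).congr_left fun x => ?_
      simp only [Pi.add_apply, mul_add, Finset.sum_add_distrib]
      ring

lemma HasSingExpansion.mul {y : E3} {F G : E3 → ℝ} {c d : ℝ → S2 → ℝ}
    (hF : HasSingExpansion y F c) (hG : HasSingExpansion y G d) :
    ∃ e, HasSingExpansion y (fun x => F x * G x) e := by
  classical
  obtain ⟨a₀, ha₀⟩ := hF.bddBelow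
  obtain ⟨b₀, hb₀⟩ := hG.bddBelow
  have hc0 : ∀ a, c a ≠ 0 → a₀ ≤ a := fun a h => not_lt.1 fun h' => h (ha₀ a h')
  have hd0 : ∀ a, d a ≠ 0 → b₀ ≤ a := fun a h => not_lt.1 fun h' => h (hb₀ a h')
  let SF : ℝ → Finset ℝ := fun N => (hF.finite_exponents N).toFinset
  let SG : ℝ → Finset ℝ := fun N => (hG.finite_exponents N).toFinset
  have hSF : ∀ N a, a ∈ SF N ↔ a ≤ N ∧ c a ≠ 0 := fun N a => by simp [SF]
  have hSG : ∀ N a, a ∈ SG N ↔ a ≤ N ∧ d a ≠ 0 := fun N a => by simp [SG]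
  let e : ℝ → S2 → ℝ := fun a => ∑ b ∈ SF (a - b₀), c b * d (a - b)
  -- `e` is the full fibre sum
  have he : ∀ M a, a - b₀ ≤ M → a - a₀ ≤ M → 
      e a = ∑ x ∈ (SF M ×ˢ SG M) with x.1 + x.2 = a, c x.1 * d x.2 := by
    intro M a h1 h2
    have : e a = ∑ b ∈ SF M, c b * d (a - b) := by
      refine Finset.sum_subset ?_ ?_
      · intro b hb
        rw [hSF] at hb ⊢
        exact ⟨hb.1.trans h1, hb.2⟩
      · intro b hb hb'
        rw [hSF] at hb hb'
        have : d (a - b) = 0 := by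
          refine hb₀ _ ?_
          by_contra hh
          exact hb' ⟨by linarith, hb.2⟩
        rw [this, mul_zero]
    rw [this, Finset.sum_filter, Finset.sum_product]
    refine Finset.sum_congr rfl fun b hb => ?_
    rw [hSF] at hb
    simp only
    have hb0 := hc0 b hb.2
    by_cases hd : d (a - b) = 0
    · rw [hd, mul_zero]
      symm
      refine Finset.sum_eq_zero fun x hx => ?_
      split_ifs with hxa
      · rw [show x = a - b by linarith, hd, mul_zero]
      · rfl
    · rw [Finset.sum_eq_single (a - b)]
      · rw [if_pos (by ring)]
      · intro x _ hx
        rw [if_neg]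
        intro h; apply hx; linarith
      · intro h
        exfalso; apply h
        rw [hSG]
        exact ⟨by linarith, hd⟩
  have hne : ∀ M a, a - b₀ ≤ M → a - a₀ ≤ M → e a ≠ 0 →
      a ∈ (SF M ×ˢ SG M).image (fun x => x.1 + x.2) := by
    intro M a h1 h2 h
    rw [he M a h1 h2] at h
    obtain ⟨x, hx, -⟩ := Finset.exists_ne_zero_of_sum_ne_zero h
    rw [Finset.mem_filter] at hx
    exact Finset.mem_image.2 ⟨x, hx.1, hx.2⟩
  refine ⟨e, ?_, ?_, ?_, ?_⟩
  · intro a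
    exact SmoothSphereFn.sum _ _ fun b => (hF.smooth_coeffs b).mul (hG.smooth_coeffs _)
  · refine ⟨a₀ + b₀, fun a ha => Finset.sum_eq_zero fun b hb => ?_⟩
    rw [hSF] at hb
    have := hc0 b hb.2
    linarith [hb.1]
  · intro N
    let M := max (N - b₀) (N - a₀)
    refine ((SF M ×ˢ SG M).image (fun x => x.1 + x.2)).finite_toSet.subset ?_
    rintro a ⟨ha, h⟩
    refine hne M a ?_ ?_ h
    · exact le_trans (by linarith) (le_max_left _ _)
    · exact le_trans (by linarith) (le_max_right _ _)
  · intro N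
    obtain ⟨M, hM⟩ := exists_nat_ge (max (max ((N : ℝ) - b₀) (N - a₀)) N)
    have hM1 : (N : ℝ) - b₀ ≤ M := le_trans (le_trans (le_max_left _ _) (le_max_left _ _)) hM
    have hM2 : (N : ℝ) - a₀ ≤ M := le_trans (le_trans (le_max_right _ _) (le_max_left _ _)) hM
    have hM3 : (N : ℝ) ≤ M := le_trans (le_max_right _ _) hM
    let c' : ℝ → S2 → ℝ := fun a => ∑ x ∈ (SF M ×ˢ SG M) with x.1 + x.2 = a, c x.1 * d x.2
    refine expansion_of y (fun x => F x * G x) N ((SF M ×ˢ SG M).image (fun x => x.1 + x.2)) c' ?_ ?_ ?_ ?_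
    · intro a _ ha
      exact (he M a (by linarith) (by linarith)).symm
    · intro a ha h
      exact hne M a (by linarith) (by linarith) h
    · intro a
      exact (SmoothSphereFn.sum _ (fun b : ℝ × ℝ => c b.1 * d b.2) fun b =>
        (hF.smooth_coeffs b.1).mul (hG.smooth_coeffs b.2)).bdd
    · have e1 := hF.trunc M (SF M) (fun a ha => ((hSF _ _).1 ha).1)
        (fun a ha h => (hSF _ _).2 ⟨ha, h⟩)
      have e2 := hG.trunc M (SG M) (fun a ha => ((hSG _ _).1 ha).1)
        (fun a ha h => (hSG _ _).2 ⟨ha, h⟩)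
      have b1 : (fun x : ℝ × S2 => ∑ a ∈ SF M, x.1 ^ a * c a x.2) =O[lf] fun x => x.1 ^ a₀ :=
        IsBigO.fun_sum fun a ha => term_isBigO (hF.smooth_coeffs a).bdd (hc0 a ((hSF _ _).1 ha).2)
      have b2 : (fun x : ℝ × S2 => ∑ a ∈ SG M, x.1 ^ a * d a x.2) =O[lf] fun x => x.1 ^ b₀ :=
        IsBigO.fun_sum fun a ha => term_isBigO (hG.smooth_coeffs a).bdd (hd0 a ((hSG _ _).1 ha).2)
      have key : ∀ u v : ℝ, (N : ℝ) ≤ u + v →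
          (fun x : ℝ × S2 => x.1 ^ u * x.1 ^ v) =O[lf] fun x => x.1 ^ (N : ℝ) := by
        intro u v huv
        refine (rpow_isBigO huv).congr' ?_ EventuallyEq.rfl
        filter_upwards [pos_lf] with x hx
        rw [Real.rpow_add hx]
      have t1 := (b1.mul_isLittleO e2).trans_isBigO (key _ _ (by linarith))
      have t2 := (e1.mul_isBigO b2).trans_isBigO (key _ _ (by linarith))
      have t3 := (e1.mul e2).trans_isBigO (key _ _ (by
        have : (0 : ℝ) ≤ M := Nat.cast_nonneg M
        linarith))
      refine ((t1.add t2).add t3).congr' ?_ EventuallyEq.rfl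
      filter_upwards [pos_lf] with x hx
      have : ∑ a ∈ (SF M ×ˢ SG M).image (fun x => x.1 + x.2), x.1 ^ a * c' a x.2 =
          (∑ a ∈ SF M, x.1 ^ a * c a x.2) * ∑ a ∈ SG M, x.1 ^ a * d a x.2 := by
        rw [Finset.sum_mul_sum, ← Finset.sum_product',
          ← Finset.sum_fiberwise_of_maps_to (g := fun z : ℝ × ℝ => z.1 + z.2)
          (t := (SF M ×ˢ SG M).image (fun x => x.1 + x.2))
          (fun z hz => Finset.mem_image_of_mem _ hz)]
        refine Finset.sum_congr rfl fun a _ => ?_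
        simp only [c', Finset.sum_apply, Finset.mul_sum, Pi.mul_apply]
        refine Finset.sum_congr rfl fun z hz => ?_
        rw [← (Finset.mem_filter.1 hz).2, Real.rpow_add hx]
        ring
      rw [this]
      ring

/-- exact monomials -/
lemma HasSingExpansion.monomial (y : E3) (i : Fin 3) (k : ℝ) :
    ∃ c, HasSingExpansion y (fun x => k * ((x - y) i / ‖x - y‖ ^ 2)) c := by
  classical
  let c : ℝ → S2 → ℝ := fun a n => if a = -1 then k * (n : E3) i else 0
  have hc : ∀ a, a ≠ -1 → c a = 0 := fun a ha => by ext n; simp [c, ha]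
  have hs : ∀ a, SmoothSphereFn (c a) := by
    intro a
    by_cases ha : a = -1
    · refine ⟨fun x => k * x i, by fun_prop, fun n => by simp [c, ha]⟩
    · rw [hc a ha]; exact SmoothSphereFn.zero
  refine ⟨c, hs, ⟨-1, fun a ha => hc a ha.ne⟩, ?_, ?_⟩
  · intro N
    refine (Set.finite_singleton (-1 : ℝ)).subset ?_
    rintro a ⟨_, h⟩
    by_contra hn
    exact h (hc a hn)
  · intro N
    refine expansion_of y (fun x => k * ((x - y) i / ‖x - y‖ ^ 2)) N {-1} c (fun _ _ _ => rfl) ?_ (fun a => (hs a).bdd) ?_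
    · intro a _ h
      by_contra hn
      exact h (hc a (by simpa using hn))
    · refine (isLittleO_zero _ _).congr' ?_ EventuallyEq.rfl
      filter_upwards [pos_lf] with x hx
      have hn : ‖(x.2 : E3)‖ = 1 := by simp
      simp [c, norm_smul, hn, abs_of_pos hx, Real.rpow_neg_one]
      field_simp
      simp

/-! ### Integration lemmas -/

lemma polar_integral (f : ℝ → ℝ) (g : E3 → ℝ) :
    ∫ z : E3, f ‖z‖ * g (‖z‖⁻¹ • z) =
      (∫ n : S2, g n ∂dOmega) * ∫ r in Set.Ioi (0 : ℝ), r ^ 2 * f r := by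
  have h3 : Module.finrank ℝ E3 - 1 = 2 := by simp
  calc
    ∫ z : E3, f ‖z‖ * g (‖z‖⁻¹ • z)
      = ∫ z : ({(0)}ᶜ : Set E3), f ‖z.1‖ * g (‖z.1‖⁻¹ • z.1) ∂((volume : Measure E3).comap (↑)) := by
        rw [integral_subtype_comap (measurableSet_singleton _).compl
          fun z : E3 => f ‖z‖ * g (‖z‖⁻¹ • z), restrict_compl_singleton]
    _ = ∫ x, g x.1 * f x.2 ∂((volume : Measure E3).toSphere.prod
          (.volumeIoiPow (Module.finrank ℝ E3 - 1))) := by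
        have := (volume : Measure E3).measurePreserving_homeomorphUnitSphereProd.integral_comp
          (Homeomorph.measurableEmbedding _) (fun x : S2 × Set.Ioi (0 : ℝ) => g x.1 * f x.2)
        rw [← this]
        refine integral_congr_ae (Eventually.of_forall fun z => ?_)
        simp [mul_comm]
    _ = (∫ n : S2, g n ∂dOmega) *
          ∫ x : Set.Ioi (0 : ℝ), f x ∂(.volumeIoiPow (Module.finrank ℝ E3 - 1)) :=
        integral_prod_mul (fun n : S2 => g n) (fun x : Set.Ioi (0 : ℝ) => f x)
    _ = _ := by
      congr 1
      rw [h3]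
      simp only [Measure.volumeIoiPow, ENNReal.ofReal]
      rw [integral_withDensity_eq_integral_smul,
        integral_subtype_comap measurableSet_Ioi fun a ↦ Real.toNNReal (a ^ 2) • f a,
        setIntegral_congr_fun measurableSet_Ioi fun x hx ↦ ?_]
      · simp only [NNReal.smul_def]
        rw [Real.coe_toNNReal _ (pow_nonneg (le_of_lt hx) _), smul_eq_mul]
      · exact (measurable_subtype_coe.pow_const _).real_toNNReal

lemma uniq_coeff (S : Finset ℝ) (γ : ℝ → ℝ) (N : ℝ) (hS : ∀ a ∈ S, a ≤ N)
    (h : (fun r : ℝ => ∑ a ∈ S, r ^ a * γ a) =o[𝓝[>] (0 : ℝ)] fun r => r ^ N) :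
    ∀ a ∈ S, γ a = 0 := by
  classical
  by_contra! hcon
  obtain ⟨a, haS, ha⟩ := hcon
  set T := S.filter (fun a => γ a ≠ 0) with hT
  have hne : T.Nonempty := ⟨a, by simp [hT, haS, ha]⟩
  set m := T.min' hne with hm
  have hmT : m ∈ T := T.min'_mem hne
  have hmS : m ∈ S := (Finset.mem_filter.1 hmT).1
  have hγm : γ m ≠ 0 := (Finset.mem_filter.1 hmT).2
  have hsum : ∀ r : ℝ, ∑ a ∈ S, r ^ a * γ a = ∑ a ∈ T, r ^ a * γ a := by
    intro r
    symm
    refine Finset.sum_subset (Finset.filter_subset _ _) fun x hx hx' => ?_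
    have : γ x = 0 := by
      by_contra h0
      exact hx' (Finset.mem_filter.2 ⟨hx, h0⟩)
    rw [this, mul_zero]
  have hpow : ∀ b : ℝ, 0 ≤ b → Tendsto (fun r : ℝ => r ^ b) (𝓝[>] 0) (𝓝 ((0 : ℝ) ^ b)) := by
    intro b hb
    exact (Real.continuousAt_rpow_const 0 b (Or.inr hb)).tendsto.mono_left nhdsWithin_le_nhds
  have t1 : Tendsto (fun r : ℝ => r ^ (-m) * ∑ a ∈ S, r ^ a * γ a) (𝓝[>] 0) (𝓝 (γ m)) := by
    have t : Tendsto (fun r : ℝ => ∑ a ∈ T, r ^ (a - m) * γ a) (𝓝[>] 0)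
        (𝓝 (∑ a ∈ T, (0 : ℝ) ^ (a - m) * γ a)) := by
      refine tendsto_finsetSum _ fun b hb => ?_
      exact (hpow (b - m) (sub_nonneg.2 (T.min'_le b hb))).mul_const _
    have e : ∑ a ∈ T, (0 : ℝ) ^ (a - m) * γ a = γ m := by
      rw [Finset.sum_eq_single m]
      · simp
      · intro b _ hb
        rw [Real.zero_rpow (sub_ne_zero.2 hb), zero_mul]
      · intro h; exact absurd hmT h
    rw [e] at t
    refine t.congr' ?_
    filter_upwards [self_mem_nhdsWithin] with r hr
    rw [hsum, Finset.mul_sum]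
    refine Finset.sum_congr rfl fun b _ => ?_
    rw [sub_eq_neg_add, Real.rpow_add hr, mul_assoc]
  have t2 : Tendsto (fun r : ℝ => r ^ (-m) * ∑ a ∈ S, r ^ a * γ a) (𝓝[>] 0) (𝓝 0) := by
    have o1 := (isBigO_refl (fun r : ℝ => r ^ (-m)) (𝓝[>] 0)).mul_isLittleO h
    have o2 : (fun r : ℝ => r ^ (-m) * r ^ N) =O[𝓝[>] 0] fun _ => (1 : ℝ) := by
      refine ((hpow _ (sub_nonneg.2 (hS m hmS))).isBigO_one ℝ).congr' ?_ EventuallyEq.rfl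
      filter_upwards [self_mem_nhdsWithin] with r hr
      rw [sub_eq_neg_add, Real.rpow_add hr]
    exact (isLittleO_one_iff ℝ).1 (o1.trans_isBigO o2)
  exact hγm (tendsto_nhds_unique t1 t2)

def annulus : Set E3 := {z | 1 ≤ ‖z‖ ∧ ‖z‖ ≤ 2}

lemma annulus_compact : IsCompact annulus := by
  refine (isCompact_closedBall (0 : E3) 2).of_isClosed_subset ?_ ?_
  · exact (isClosed_le continuous_const continuous_norm).inter
      (isClosed_le continuous_norm continuous_const)
  · intro z hz; simpa using hz.2

lemma integrable_annulus {f : E3 → ℝ} (hf : ContinuousOn f annulus)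
    (h0 : ∀ z ∉ annulus, f z = 0) : Integrable f := by
  rw [← integrableOn_iff_integrable_of_support_subset (s := annulus)]
  · exact hf.integrableOn_compact annulus_compact
  · intro z hz
    by_contra h
    exact hz (h0 z h)

lemma annulus_ne {z : E3} (hz : z ∈ annulus) : ‖z‖ ≠ 0 := by
  have := hz.1; intro h; linarith

lemma integral_expansion {y : E3} {X : E3 → ℝ} {c : ℝ → S2 → ℝ} (hX : HasSingExpansion y X c)
    {δ : ℝ} (hδ : 0 < δ) (hcont : ContinuousOn X (Metric.ball y δ \ {y}))
    {w : E3 → ℝ} (hw : ContinuousOn w annulus) (hw0 : ∀ z ∉ annulus, w z = 0)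
    {g : ℝ → E3 → ℝ} (hg : ∀ a, Continuous (g a)) (hgc : ∀ a (n : S2), g a n = c a n)
    (N : ℕ) (S : Finset ℝ)
    (h1 : ∀ a ∈ S, a ≤ (N : ℝ)) (h2 : ∀ a ≤ (N : ℝ), c a ≠ 0 → a ∈ S) :
    (fun t : ℝ => (∫ z, w z * X (y + t • z)) -
      ∑ a ∈ S, t ^ a * ∫ z, w z * (‖z‖ ^ a * g a (‖z‖⁻¹ • z))) =o[𝓝[>] (0 : ℝ)]
      fun t => t ^ (N : ℝ) := by
  have hwi : Integrable w := integrable_annulus hw hw0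
  have hterm : ∀ a, Integrable (fun z : E3 => w z * (‖z‖ ^ a * g a (‖z‖⁻¹ • z))) := by
    intro a
    refine integrable_annulus (hw.mul (ContinuousOn.mul ?_ ?_)) fun z hz => by simp [hw0 z hz]
    · exact continuous_norm.continuousOn.rpow_const fun z hz => Or.inl (annulus_ne hz)
    · refine (hg a).comp_continuousOn (ContinuousOn.fun_smul ?_ continuousOn_id)
      exact continuous_norm.continuousOn.inv₀ fun z hz => annulus_ne hz
  set C : ℝ := 2 ^ (N : ℝ) * ∫ z, |w z| with hC
  have hC0 : 0 ≤ C := by positivity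
  rw [isLittleO_iff]
  intro ε hε
  have hε' : 0 < ε / (C + 1) := by positivity
  obtain ⟨ρ, hρ, hb⟩ := eventually_lf.1 ((isLittleO_iff.1 (hX.trunc N S h1 h2)) hε')
  have hpos : (0 : ℝ) < min (δ / 3) (ρ / 3) := by positivity
  filter_upwards [Ioo_mem_nhdsGT hpos] with t ht
  have ht0 : 0 < t := ht.1
  have ht1 : t < δ / 3 := ht.2.trans_le (min_le_left _ _)
  have ht2 : t < ρ / 3 := ht.2.trans_le (min_le_right _ _)
  have hXi : Integrable (fun z : E3 => w z * X (y + t • z)) := by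
    refine integrable_annulus (hw.mul ?_) fun z hz => by simp [hw0 z hz]
    refine hcont.comp (by fun_prop) ?_
    intro z hz
    refine ⟨?_, ?_⟩
    · simp only [Metric.mem_ball, dist_eq_norm, add_sub_cancel_left, norm_smul, Real.norm_eq_abs,
        abs_of_pos ht0]
      have := hz.2
      nlinarith
    · simp only [Set.mem_singleton_iff, add_eq_left, smul_eq_zero, not_or]
      exact ⟨ht0.ne', fun h => annulus_ne hz (by simp [h])⟩
  have heq : (∫ z, w z * X (y + t • z)) -
      ∑ a ∈ S, t ^ a * ∫ z, w z * (‖z‖ ^ a * g a (‖z‖⁻¹ • z)) =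
      ∫ z, (w z * X (y + t • z) -
        ∑ a ∈ S, t ^ a * (w z * (‖z‖ ^ a * g a (‖z‖⁻¹ • z)))) := by
    rw [integral_sub hXi (integrable_finsetSum _ fun a _ => (hterm a).const_mul _),
      integral_finsetSum _ fun a _ => (hterm a).const_mul _]
    simp only [integral_const_mul]
  rw [heq]
  have hbound : ∀ z : E3, ‖w z * X (y + t • z) -
        ∑ a ∈ S, t ^ a * (w z * (‖z‖ ^ a * g a (‖z‖⁻¹ • z)))‖ ≤
        |w z| * (ε / (C + 1) * (2 ^ (N : ℝ) * t ^ (N : ℝ))) := by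
    intro z
    by_cases hz : z ∈ annulus
    · have hz0 : 0 < ‖z‖ := by linarith [hz.1]
      let n : S2 := ⟨‖z‖⁻¹ • z, by
        simp [norm_smul, hz0.ne']⟩
      have hb' := hb (t * ‖z‖) (by positivity) (by nlinarith [hz.2]) n
      have e1 : (t * ‖z‖) • (n : E3) = t • z := by
        simp only [n, smul_smul]
        congr 1
        field_simp
      simp only [e1] at hb'
      have e2 : w z * X (y + t • z) - ∑ a ∈ S, t ^ a * (w z * (‖z‖ ^ a * g a (‖z‖⁻¹ • z))) =
          w z * (X (y + t • z) - ∑ a ∈ S, (t * ‖z‖) ^ a * c a n) := by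
        rw [mul_sub, Finset.mul_sum]
        congr 1
        refine Finset.sum_congr rfl fun a _ => ?_
        rw [← hgc a n, Real.mul_rpow ht0.le hz0.le]
        ring
      rw [e2, norm_mul, Real.norm_eq_abs (w z)]
      refine mul_le_mul_of_nonneg_left (hb'.trans ?_) (abs_nonneg _)
      refine mul_le_mul_of_nonneg_left ?_ hε'.le
      rw [Real.norm_eq_abs, abs_of_pos (by positivity), ← Real.mul_rpow (by norm_num) ht0.le]
      exact Real.rpow_le_rpow (by positivity) (by nlinarith [hz.2]) (Nat.cast_nonneg _)
    · simp [hw0 z hz]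
  refine (norm_integral_le_of_norm_le (hwi.abs.mul_const _) (Eventually.of_forall hbound)).trans ?_
  rw [integral_mul_const, Real.norm_eq_abs, abs_of_pos (by positivity)]
  have : (∫ z, |w z|) * (ε / (C + 1) * (2 ^ (N : ℝ) * t ^ (N : ℝ))) =
      (ε * t ^ (N : ℝ)) * (C / (C + 1)) := by rw [hC]; ring
  rw [this]
  exact mul_le_of_le_one_right (by positivity) (by rw [div_le_one (by positivity)]; linarith)

lemma exists_cutoff : ∃ ψ : ℝ → ℝ, ContDiff ℝ (⊤ : ℕ∞) ψ ∧ (∀ t, t < 1 ∨ 3 < t → ψ t = 0) ∧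
    (∀ t, 0 ≤ ψ t) ∧ 0 < ψ 2 := by
  let b : ContDiffBump (2 : ℝ) := ⟨1 / 2, 1, by norm_num, by norm_num⟩
  refine ⟨b, b.contDiff, ?_, fun t => b.nonneg, ?_⟩
  · intro t ht
    refine b.zero_of_le_dist ?_
    change (1 : ℝ) ≤ _
    rw [Real.dist_eq]
    rcases ht with ht | ht
    · rw [abs_of_neg (by linarith)]; linarith
    · rw [abs_of_pos (by linarith)]; linarith
  · exact b.pos_of_mem_ball (Metric.mem_ball_self (by change (0 : ℝ) < 1; norm_num))

section Cutoff

variable {ψ : ℝ → ℝ}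

lemma cutoff_deriv (h0 : ∀ t, t < 1 ∨ 3 < t → ψ t = 0) :
    ∀ t, t < 1 ∨ 3 < t → deriv ψ t = 0 := by
  intro t ht
  have : ψ =ᶠ[𝓝 t] fun _ => 0 := by
    have ho : IsOpen {t : ℝ | t < 1 ∨ 3 < t} := isOpen_Iio.union isOpen_Ioi
    filter_upwards [ho.mem_nhds ht] with s hs using h0 s hs
  rw [this.deriv_eq]; simp

lemma cutoff_integral_pos (hψ : ContDiff ℝ (⊤ : ℕ∞) ψ) (h0 : ∀ t, t < 1 ∨ 3 < t → ψ t = 0)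
    (hn : ∀ t, 0 ≤ ψ t) (h2 : 0 < ψ 2) :
    0 < ∫ r in Set.Ioi (0 : ℝ), r ^ 2 * ψ (r ^ 2) := by
  have hc : Continuous fun r : ℝ => r ^ 2 * ψ (r ^ 2) := by
    have := hψ.continuous; fun_prop
  have hcs : HasCompactSupport fun r : ℝ => r ^ 2 * ψ (r ^ 2) := by
    refine HasCompactSupport.intro (isCompact_Icc (a := (-2 : ℝ)) (b := 2)) fun r hr => ?_
    rw [h0 _ (Or.inr ?_), mul_zero]
    by_contra h
    apply hr
    constructor <;> nlinarith
  rw [setIntegral_pos_iff_support_of_nonneg_ae]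
  · refine IsOpen.measure_pos _ (hc.isOpen_support.inter isOpen_Ioi) ⟨√2, ?_, ?_⟩
    · simp [h2.ne']
    · simp
  · exact Eventually.of_forall fun r => mul_nonneg (sq_nonneg r) (hn _)
  · exact (hc.integrable_of_hasCompactSupport hcs).integrableOn

lemma cutoff_integral_zero (hψ : ContDiff ℝ (⊤ : ℕ∞) ψ) (h0 : ∀ t, t < 1 ∨ 3 < t → ψ t = 0) :
    ∫ r in Set.Ioi (0 : ℝ), r ^ 2 * (r ^ 2 * (2 * deriv ψ (r ^ 2) + 3 * ψ (r ^ 2) / r ^ 2)) = 0 := by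
  have hd := cutoff_deriv h0
  have hcd : Continuous (deriv ψ) := hψ.continuous_deriv (by simp)
  have hc : Continuous fun r : ℝ => 2 * r ^ 4 * deriv ψ (r ^ 2) + 3 * r ^ 2 * ψ (r ^ 2) := by
    have := hψ.continuous; fun_prop
  have hbig : ∀ r : ℝ, r ∉ Set.Icc (-2 : ℝ) 2 → 3 < r ^ 2 := by
    intro r hr
    by_contra h
    apply hr
    constructor <;> nlinarith
  have hcs : HasCompactSupport
      fun r : ℝ => 2 * r ^ 4 * deriv ψ (r ^ 2) + 3 * r ^ 2 * ψ (r ^ 2) := by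
    refine HasCompactSupport.intro (isCompact_Icc (a := (-2 : ℝ)) (b := 2)) fun r hr => ?_
    rw [h0 _ (Or.inr (hbig r hr)), hd _ (Or.inr (hbig r hr))]
    simp
  have hder : ∀ r : ℝ, HasDerivAt (fun r : ℝ => r ^ 3 * ψ (r ^ 2))
      (2 * r ^ 4 * deriv ψ (r ^ 2) + 3 * r ^ 2 * ψ (r ^ 2)) r := by
    intro r
    have h1 : HasDerivAt ψ (deriv ψ (r ^ 2)) (r ^ 2) :=
      (hψ.differentiable (by simp) _).hasDerivAt
    have h2 := (hasDerivAt_pow 3 r).mul (HasDerivAt.comp (h₂ := ψ) (h := fun r : ℝ => r ^ 2) r h1 (hasDerivAt_pow 2 r))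
    refine HasDerivAt.congr_deriv (f := fun r : ℝ => r ^ 3 * ψ (r ^ 2)) h2 ?_
    simp only [Function.comp]
    norm_num
    ring
  have ht : Tendsto (fun r : ℝ => r ^ 3 * ψ (r ^ 2)) atTop (𝓝 0) := by
    refine tendsto_const_nhds.congr' ?_
    filter_upwards [eventually_gt_atTop 2] with r hr
    rw [h0 _ (Or.inr (by nlinarith)), mul_zero]
  have := integral_Ioi_of_hasDerivAt_of_tendsto' (a := 0) (fun r _ => hder r)
    (hc.integrable_of_hasCompactSupport hcs).integrableOn ht
  simp only [ne_eq, OfNat.ofNat_ne_zero, not_false_eq_true, zero_pow, zero_mul, sub_zero] at this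
  refine Eq.trans ?_ this
  refine setIntegral_congr_fun measurableSet_Ioi fun r hr => ?_
  have : r ≠ 0 := ne_of_gt hr
  field_simp

end Cutoff

/-! ### The key vanishing lemma -/

lemma ibp_identity {y : E3} {H K : E3 → ℝ} {i : Fin 3} {δ : ℝ}
    (hH : ContDiffOn ℝ (⊤ : ℕ∞) H (Metric.ball y δ \ {y}))
    (hKc : ContinuousOn K (Metric.ball y δ \ {y}))
    (hK : ∀ x ∈ Metric.ball y δ \ {y},
      K x = pder i H x - 3 * ((x - y) i / ‖x - y‖ ^ 2) * H x)
    {ψ : ℝ → ℝ} (hψ : ContDiff ℝ (⊤ : ℕ∞) ψ) (h0 : ∀ t, t < 1 ∨ 3 < t → ψ t = 0)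
    {t : ℝ} (ht0 : 0 < t) (ht : t < δ / 3) :
    t * (∫ z : E3, ψ (‖z‖ ^ 2) * K (y + t • z)) +
      ∫ z : E3, (z i * (2 * deriv ψ (‖z‖ ^ 2) + 3 * ψ (‖z‖ ^ 2) / ‖z‖ ^ 2)) * H (y + t • z) = 0 := by
  have hd := cutoff_deriv h0
  have hcd : Continuous (deriv ψ) := hψ.continuous_deriv (by simp)
  have hopen : IsOpen (Metric.ball y δ \ {y}) := Metric.isOpen_ball.sdiff isClosed_singleton
  have hout : ∀ z : E3, z ∉ annulus → ‖z‖ ^ 2 < 1 ∨ 3 < ‖z‖ ^ 2 := by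
    intro z hz
    have := norm_nonneg z
    by_contra! h
    exact hz ⟨by nlinarith, by nlinarith⟩
  have hmem : ∀ z ∈ annulus, y + t • z ∈ Metric.ball y δ \ {y} := by
    intro z hz
    refine ⟨?_, ?_⟩
    · simp only [Metric.mem_ball, dist_eq_norm, add_sub_cancel_left, norm_smul, Real.norm_eq_abs,
        abs_of_pos ht0]
      have := hz.2
      nlinarith
    · simp only [Set.mem_singleton_iff, add_eq_left, smul_eq_zero, not_or]
      exact ⟨ht0.ne', fun h => annulus_ne hz (by simp [h])⟩
  have hmaps : ContinuousOn (fun z : E3 => y + t • z) annulus := by fun_prop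
  have i1 : Integrable fun z : E3 => ψ (‖z‖ ^ 2) * K (y + t • z) := by
    refine integrable_annulus (ContinuousOn.mul ?_ (hKc.comp hmaps hmem))
      fun z hz => by simp [h0 _ (hout z hz)]
    have := hψ.continuous
    fun_prop
  have i2 : Integrable fun z : E3 =>
      (z i * (2 * deriv ψ (‖z‖ ^ 2) + 3 * ψ (‖z‖ ^ 2) / ‖z‖ ^ 2)) * H (y + t • z) := by
    refine integrable_annulus (ContinuousOn.mul ?_ (hH.continuousOn.comp hmaps hmem))
      fun z hz => by simp [h0 _ (hout z hz), hd _ (hout z hz)]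
    have := hψ.continuous
    refine ContinuousOn.mul (by fun_prop) (ContinuousOn.add (by fun_prop) ?_)
    refine ContinuousOn.div (by fun_prop) (by fun_prop) fun z hz => ?_
    exact pow_ne_zero _ (annulus_ne hz)
  let g : E3 → ℝ := fun z => ψ (‖z‖ ^ 2) * H (y + t • z)
  have i3 : Integrable g := by
    refine integrable_annulus (ContinuousOn.mul ?_ (hH.continuousOn.comp hmaps hmem))
      fun z hz => by simp [g, h0 _ (hout z hz)]
    have := hψ.continuous
    fun_prop
  have hg : ∀ z : E3, DifferentiableAt ℝ g z ∧
      fderiv ℝ g z (EuclideanSpace.single i 1) = t * (ψ (‖z‖ ^ 2) * K (y + t • z)) +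
        (z i * (2 * deriv ψ (‖z‖ ^ 2) + 3 * ψ (‖z‖ ^ 2) / ‖z‖ ^ 2)) * H (y + t • z) := by
    intro z
    by_cases hz : z ∈ annulus
    · have hHd : HasFDerivAt H (fderiv ℝ H (y + t • z)) (y + t • z) :=
        ((hH.contDiffAt (hopen.mem_nhds (hmem z hz))).differentiableAt (by simp)).hasFDerivAt
      have ha : HasFDerivAt (fun z : E3 => y + t • z) (t • ContinuousLinearMap.id ℝ E3) z :=
        ((hasFDerivAt_id z).const_smul t).const_add y
      have h1 := hHd.comp z ha
      have hs : HasFDerivAt (fun z : E3 => ‖z‖ ^ 2) (2 • (innerSL ℝ z)) z :=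
        (hasStrictFDerivAt_norm_sq z).hasFDerivAt
      have h2 : HasFDerivAt (fun z : E3 => ψ (‖z‖ ^ 2)) (deriv ψ (‖z‖ ^ 2) • (2 • (innerSL ℝ z))) z :=
        HasDerivAt.comp_hasFDerivAt z (hψ.differentiable (by simp) _).hasDerivAt hs
      have h3 := h2.mul h1
      refine ⟨h3.differentiableAt, ?_⟩
      have h4 : fderiv ℝ g z = _ := h3.fderiv
      rw [h4, hK _ (hmem z hz)]
      have hzn : ‖z‖ ≠ 0 := annulus_ne hz
      have hin : inner ℝ z (EuclideanSpace.single i (1 : ℝ)) = z i := by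
        rw [EuclideanSpace.inner_single_right]; simp
      simp [pder, hin, norm_smul, abs_of_pos ht0]
      field_simp
      ring
    · have hev : g =ᶠ[𝓝 z] fun _ => 0 := by
        filter_upwards [annulus_compact.isClosed.isOpen_compl.mem_nhds hz] with u hu
        simp [g, h0 _ (hout u hu)]
      refine ⟨(differentiableAt_const _).congr_of_eventuallyEq hev, ?_⟩
      rw [hev.fderiv_eq]
      simp [h0 _ (hout z hz), hd _ (hout z hz)]
  have hfd : (fun z => fderiv ℝ g z (EuclideanSpace.single i 1)) = fun z : E3 =>
      t * (ψ (‖z‖ ^ 2) * K (y + t • z)) +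
        (z i * (2 * deriv ψ (‖z‖ ^ 2) + 3 * ψ (‖z‖ ^ 2) / ‖z‖ ^ 2)) * H (y + t • z) :=
    funext fun z => (hg z).2
  have hIBP := integral_mul_fderiv_eq_neg_fderiv_mul_of_integrable (𝕜 := ℝ)
    (μ := (volume : Measure E3)) (f := fun _ => (1 : ℝ)) (g := g)
    (v := EuclideanSpace.single i 1) (by simp)
    (by simp only [one_mul]; rw [hfd]; exact (i1.const_mul t).add i2)
    (by simpa using i3) (fun _ _ => differentiableAt_const _) (fun z _ => (hg z).1)
  simp only [one_mul, hfd] at hIBP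
  rw [integral_add (i1.const_mul t) i2, integral_const_mul] at hIBP
  rw [hIBP]
  simp

lemma vanishing {y : E3} {H K : E3 → ℝ} {h k : ℝ → S2 → ℝ} {i : Fin 3} {δ : ℝ} (hδ : 0 < δ)
    (hH : ContDiffOn ℝ (⊤ : ℕ∞) H (Metric.ball y δ \ {y}))
    (hKc : ContinuousOn K (Metric.ball y δ \ {y}))
    (hK : ∀ x ∈ Metric.ball y δ \ {y},
      K x = pder i H x - 3 * ((x - y) i / ‖x - y‖ ^ 2) * H x)
    (eH : HasSingExpansion y H h) (eK : HasSingExpansion y K k) :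
    ∫ n : S2, k 0 n ∂dOmega = 0 := by
  classical
  obtain ⟨ψ, hψ, h0, hn, hp⟩ := exists_cutoff
  have hd := cutoff_deriv h0
  have hcd : Continuous (deriv ψ) := hψ.continuous_deriv (by simp)
  have hout : ∀ z : E3, z ∉ annulus → ‖z‖ ^ 2 < 1 ∨ 3 < ‖z‖ ^ 2 := by
    intro z hz
    have := norm_nonneg z
    by_contra! h
    exact hz ⟨by nlinarith, by nlinarith⟩
  choose gh hgh hgh' using eH.smooth_coeffs
  choose gk hgk hgk' using eK.smooth_coeffs
  let χ : E3 → ℝ := fun z => ψ (‖z‖ ^ 2)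
  let η : E3 → ℝ := fun z => z i * (2 * deriv ψ (‖z‖ ^ 2) + 3 * ψ (‖z‖ ^ 2) / ‖z‖ ^ 2)
  have hχc : ContinuousOn χ annulus := by
    have := hψ.continuous
    fun_prop
  have hηc : ContinuousOn η annulus := by
    have := hψ.continuous
    refine ContinuousOn.mul (by fun_prop) (ContinuousOn.add (by fun_prop) ?_)
    refine ContinuousOn.div (by fun_prop) (by fun_prop) fun z hz => ?_
    exact pow_ne_zero _ (annulus_ne hz)
  have hχ0 : ∀ z ∉ annulus, χ z = 0 := fun z hz => h0 _ (hout z hz)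
  have hη0 : ∀ z ∉ annulus, η z = 0 := fun z hz => by
    simp [η, h0 _ (hout z hz), hd _ (hout z hz)]
  set S : Finset ℝ := {1} ∪ (eH.finite_exponents 1).toFinset ∪
    (eK.finite_exponents 0).toFinset.image (fun a => a + 1) with hS
  have hS1 : ∀ a ∈ S, a ≤ 1 := by
    intro a ha
    simp only [hS, Finset.mem_union, Finset.mem_singleton, Set.Finite.mem_toFinset,
      Set.mem_ofPred_eq, Finset.mem_image] at ha
    rcases ha with (rfl | ha) | ⟨b, hb, rfl⟩
    · exact le_rfl
    · exact ha.1
    · linarith [hb.1]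
  have xH := integral_expansion eH hδ hH.continuousOn hηc hη0 (fun a => (hgh a).continuous) hgh'
    1 S (by simpa using hS1) (fun a ha hne => by
      simp only [Nat.cast_one] at ha
      simp [hS, ha, hne])
  have xK := integral_expansion eK hδ hKc hχc hχ0 (fun a => (hgk a).continuous) hgk'
    0 (S.image fun a => a - 1) (by
      intro a ha
      obtain ⟨b, hb, rfl⟩ := Finset.mem_image.1 ha
      have := hS1 b hb
      simp only [Nat.cast_zero]; linarith)
    (fun a ha hne => by
      simp only [Nat.cast_zero] at ha
      refine Finset.mem_image.2 ⟨a + 1, ?_, by ring⟩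
      simp [hS, ha, hne])
  set α : ℝ → ℝ := fun a => ∫ z, χ z * (‖z‖ ^ a * gk a (‖z‖⁻¹ • z)) with hα
  set β : ℝ → ℝ := fun a => ∫ z, η z * (‖z‖ ^ a * gh a (‖z‖⁻¹ • z)) with hβ
  have key : (fun t : ℝ => ∑ a ∈ S, t ^ a * (α (a - 1) + β a)) =o[𝓝[>] (0 : ℝ)]
      fun t => t ^ (1 : ℝ) := by
    have xK' := (isBigO_refl (fun t : ℝ => t) (𝓝[>] 0)).mul_isLittleO xK
    have xH' : _ =o[𝓝[>] (0 : ℝ)] fun t : ℝ => t * t ^ ((0 : ℕ) : ℝ) :=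
      xH.congr_right (fun t => by simp)
    refine ((xK'.add xH').neg_left).congr' ?_ (Eventually.of_forall fun t => by simp)
    have hpos : (0 : ℝ) < δ / 3 := by positivity
    filter_upwards [Ioo_mem_nhdsGT hpos] with t ht
    have hI := ibp_identity hH hKc hK hψ h0 ht.1 ht.2
    have hsum : ∑ a ∈ S.image (fun a => a - 1), t ^ a * α a = ∑ a ∈ S, t ^ (a - 1) * α (a - 1) :=
      Finset.sum_image (fun a _ b _ hab => by simpa using hab)
    have hsum2 : t * ∑ a ∈ S, t ^ (a - 1) * α (a - 1) = ∑ a ∈ S, t ^ a * α (a - 1) := by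
      rw [Finset.mul_sum]
      refine Finset.sum_congr rfl fun a _ => ?_
      rw [Real.rpow_sub_one ht.1.ne']
      have := ht.1.ne'
      field_simp
    simp only [mul_add, Finset.sum_add_distrib]
    change -(t * ((∫ z, χ z * K (y + t • z)) - ∑ a ∈ S.image (fun a => a - 1), t ^ a * α a) +
      ((∫ z, η z * H (y + t • z)) - ∑ a ∈ S, t ^ a * β a)) = _
    change t * (∫ z, χ z * K (y + t • z)) + (∫ z, η z * H (y + t • z)) = 0 at hI
    rw [hsum, mul_sub, hsum2]
    linarith
  have h1 := uniq_coeff S (fun a => α (a - 1) + β a) 1 hS1 key 1 (by simp [hS])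
  simp only [sub_self] at h1
  have hα0 : α 0 = (∫ n : S2, k 0 n ∂dOmega) * ∫ r in Set.Ioi (0 : ℝ), r ^ 2 * ψ (r ^ 2) := by
    have := polar_integral (fun r => ψ (r ^ 2)) (gk 0)
    simp only [hgk'] at this
    rw [← this]
    simp [hα, χ]
  have hβ1 : β 1 = 0 := by
    have := polar_integral (fun r => r ^ 2 * (2 * deriv ψ (r ^ 2) + 3 * ψ (r ^ 2) / r ^ 2))
      (fun z => z i * gh 1 z)
    rw [cutoff_integral_zero hψ h0, mul_zero] at this
    rw [← this]
    refine integral_congr_ae (Eventually.of_forall fun z => ?_)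
    by_cases hz : z = 0
    · simp [η, hz]
    · have : ‖z‖ ≠ 0 := norm_ne_zero_iff.2 hz
      simp [η]
      field_simp
  rw [hα0, hβ1, add_zero] at h1
  exact (mul_eq_zero.1 h1).resolve_right (cutoff_integral_pos hψ h0 hn hp).ne'

lemma integrable_sphere {f : S2 → ℝ} (h : SmoothSphereFn f) : Integrable f dOmega := by
  unfold dOmega
  exact h.continuous.integrable_of_hasCompactSupport (HasCompactSupport.of_compactSpace f)

lemma exists_punctured_ball {y : E3} {F : E3 → ℝ} (h : SmoothNearPunctured y F) :
    ∃ δ > 0, ContDiffOn ℝ (⊤ : ℕ∞) F (Metric.ball y δ \ {y}) := by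
  obtain ⟨U, hU, hF⟩ := h
  obtain ⟨δ, hδ, hs⟩ := Metric.mem_nhds_iff.1 hU
  exact ⟨δ, hδ, hF.mono (Set.sdiff_subset_sdiff_left hs)⟩

/-- the identity underlying the derivative of `Pf(Gδ)`:
`(F ∂_iG)_y = −((∂_iF − 3 nⁱ r⁻¹ F) G)_y = −(r³∂_i(r⁻³F) · G)_y`. -/
theorem pf_F_times_gradient_identity
    (y : E3) (F G : E3 → ℝ)
    (hF : SmoothNearPunctured y F) (hG : SmoothNearPunctured y G)
    (cF cG : ℝ → S2 → ℝ)
    (hcF : HasSingExpansion y F cF) (hcG : HasSingExpansion y G cG)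
    (i : Fin 3)
    (hdF : ∃ e, HasSingExpansion y (pder i F) e)
    (hdG : ∃ e, HasSingExpansion y (pder i G) e) :
    (∃ p, HasSingExpansion y (fun x => F x * pder i G x) p)
    ∧ (∃ q, HasSingExpansion y
        (fun x => (pder i F x - 3 * ((x - y) i / ‖x - y‖ ^ 2) * F x) * G x) q)
    ∧ ∀ p q : ℝ → S2 → ℝ,
        HasSingExpansion y (fun x => F x * pder i G x) p →
        HasSingExpansion y
          (fun x => (pder i F x - 3 * ((x - y) i / ‖x - y‖ ^ 2) * F x) * G x) q →
        pfAt p = -pfAt q := by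
  obtain ⟨eF, heF⟩ := hdF
  obtain ⟨eG, heG⟩ := hdG
  refine ⟨hcF.mul heG, ?_, ?_⟩
  · obtain ⟨m, hm⟩ := HasSingExpansion.monomial y i (-3)
    obtain ⟨u, hu⟩ := hm.mul hcF
    obtain ⟨q, hq⟩ := (heF.add hu).mul hcG
    refine ⟨q, ?_⟩
    convert hq using 2 with x
    ring
  · intro p q hp hq
    obtain ⟨δ₁, hδ₁, sF⟩ := exists_punctured_ball hF
    obtain ⟨δ₂, hδ₂, sG⟩ := exists_punctured_ball hG
    obtain ⟨h, eH⟩ := hcF.mul hcG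
    set δ := min δ₁ δ₂ with hδ
    have hδ0 : 0 < δ := lt_min hδ₁ hδ₂
    have hopen : IsOpen (Metric.ball y δ \ {y}) := Metric.isOpen_ball.sdiff isClosed_singleton
    have sF' := sF.mono (Set.sdiff_subset_sdiff_left (t := {y})
      (Metric.ball_subset_ball (x := y) (min_le_left δ₁ δ₂)))
    have sG' := sG.mono (Set.sdiff_subset_sdiff_left (t := {y})
      (Metric.ball_subset_ball (x := y) (min_le_right δ₁ δ₂)))
    have pc : ∀ f : E3 → ℝ, ContDiffOn ℝ (⊤ : ℕ∞) f (Metric.ball y δ \ {y}) →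
        ContinuousOn (pder i f) (Metric.ball y δ \ {y}) := by
      intro f hf
      exact (hf.continuousOn_fderiv_of_isOpen hopen (by simp)).clm_apply continuousOn_const
    have hv := vanishing (i := i) hδ0 (sF'.mul sG') ?_ ?_ eH (hp.add hq)
    · have hadd : ∫ n : S2, (p 0 + q 0) n ∂dOmega =
          (∫ n : S2, p 0 n ∂dOmega) + ∫ n : S2, q 0 n ∂dOmega :=
        integral_add (integrable_sphere (hp.smooth_coeffs 0)) (integrable_sphere (hq.smooth_coeffs 0))
      rw [hadd] at hv
      unfold pfAt
      rw [eq_neg_of_add_eq_zero_left hv]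
      ring
    · refine (sF'.continuousOn.mul (pc G sG')).add
        (((pc F sF').sub (ContinuousOn.mul (continuousOn_const.mul ?_) sF'.continuousOn)).mul
          sG'.continuousOn)
      refine ContinuousOn.div (by fun_prop) (by fun_prop) fun x hx => ?_
      exact pow_ne_zero _ (norm_ne_zero_iff.2 (sub_ne_zero.2 hx.2))
    · intro x hx
      have dF : DifferentiableAt ℝ F x :=
        (sF'.contDiffAt (hopen.mem_nhds hx)).differentiableAt (by simp)
      have dG : DifferentiableAt ℝ G x :=
        (sG'.contDiffAt (hopen.mem_nhds hx)).differentiableAt (by simp)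
      have : pder i (fun x => F x * G x) x = F x * pder i G x + G x * pder i F x := by
        unfold pder
        rw [fderiv_fun_mul dF dG]
        simp
      rw [this]
      ring

end
end

section
/- (Laplacian of a pseudo-function times the Dirac pseudo-function.) Let F and G be smooth on a punctured neighbourhood of y ∈ ℝ³, and assume that F, G and all their first and second partial derivatives admit singular expansions at y. Then the Hadamard parties finies at y satisfy (F ΔG)_y = ( (ΔF − 6 r^{−1} nⁱ ∂_iF + 6 r^{−2} F) G )_y, i.e. (F ΔG)_y = ( r³ Δ(r^{−3} F) · G )_y (summation over i understood). In particular, taking F = 1: (ΔG)_y = (6 r^{−2} G)_y, and taking F = r²: (r² ΔG)_y = ( (r²ΔF-type expression) G )_y reduces to 0, i.e. (r² ΔG)_y = (2G + ... )—specifically the identity yields Δ[Pf(r²δ)] = 0 in the sense that (r² ΔG)_y = ((Δ(r²·r^{−3}·r³?)))—the clean special cases are (ΔG)_y = (6 r^{−2} G)_y and (r²ΔG)_y = 0. -/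
open MeasureTheory Filter Topology Real Asymptotics

noncomputable section

/-- The Laplacian of `F` (as a plain function, defined outside the singularity). -/
def lapl (F : E3 → ℝ) (x : E3) : ℝ :=
  ∑ i : Fin 3, pder i (pder i F) x

namespace PfAux

def ann : Set E3 := {z | 1 ≤ ‖z‖ ∧ ‖z‖ ≤ 2}
def pun (R : ℝ) : Set E3 := {z | 0 < ‖z‖ ∧ ‖z‖ < R}

lemma isOpen_pun (R : ℝ) : IsOpen (pun R) :=
  (isOpen_lt continuous_const continuous_norm).inter (isOpen_lt continuous_norm continuous_const)

lemma isClosed_ann : IsClosed ann :=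
  (isClosed_le continuous_const continuous_norm).inter
    (isClosed_le continuous_norm continuous_const)

lemma isCompact_ann : IsCompact ann := by
  refine (isCompact_closedBall (0 : E3) 2).of_isClosed_subset isClosed_ann ?_
  intro z hz
  simpa using hz.2

lemma ann_subset : ann ⊆ pun 3 := fun z hz => ⟨by linarith [hz.1], by linarith [hz.2]⟩

lemma integrable_of_ann {f : E3 → ℝ} (hf : ContinuousOn f ann) (h0 : ∀ z, z ∉ ann → f z = 0) :
    Integrable f := by
  have h1 : IntegrableOn f ann := hf.integrableOn_compact isCompact_ann
  rwa [integrableOn_iff_integrable_of_support_subset] at h1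
  intro z hz
  by_contra h
  exact hz (h0 z h)

lemma pder_mul {f g : E3 → ℝ} {z : E3} (i : Fin 3) (hf : DifferentiableAt ℝ f z)
    (hg : DifferentiableAt ℝ g z) :
    pder i (fun x => f x * g x) z = f z * pder i g z + g z * pder i f z := by
  unfold pder
  rw [fderiv_fun_mul hf hg]
  simp

lemma pder_sub {f g : E3 → ℝ} {z : E3} (i : Fin 3) (hf : DifferentiableAt ℝ f z)
    (hg : DifferentiableAt ℝ g z) :
    pder i (fun x => f x - g x) z = pder i f z - pder i g z := by
  unfold pder
  rw [fderiv_fun_sub hf hg]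
  simp

lemma hasFDerivAt_coord (j : Fin 3) (z : E3) :
    HasFDerivAt (fun x : E3 => x j) (EuclideanSpace.proj j : E3 →L[ℝ] ℝ) z :=
  (EuclideanSpace.proj j : E3 →L[ℝ] ℝ).hasFDerivAt

lemma pder_coord (i : Fin 3) (z : E3) : pder i (fun x => x i) z = 1 := by
  unfold pder
  rw [(hasFDerivAt_coord i z).fderiv]
  simp

lemma hasFDerivAt_normsq (z : E3) :
    HasFDerivAt (fun x : E3 => ‖x‖ ^ 2) ((2 : ℝ) • (innerSL ℝ z)) z := by
  have := (hasStrictFDerivAt_norm_sq z).hasFDerivAt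
  refine this.congr_fderiv ?_
  rw [two_smul, two_smul]

lemma pder_normsq (i : Fin 3) (z : E3) : pder i (fun x => ‖x‖ ^ 2) z = 2 * z i := by
  unfold pder
  rw [(hasFDerivAt_normsq z).fderiv]
  simp [EuclideanSpace.inner_single_right]

lemma pder_radial {β : ℝ → ℝ} (hβ : ContDiff ℝ (⊤ : ℕ∞) β) (i : Fin 3) (z : E3) :
    pder i (fun x => β (‖x‖ ^ 2)) z = deriv β (‖z‖ ^ 2) * (2 * z i) := by
  unfold pder
  have h1 : HasDerivAt β (deriv β (‖z‖ ^ 2)) (‖z‖ ^ 2) :=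
    ((hβ.differentiable (by simp)) _).hasDerivAt
  have := h1.comp_hasFDerivAt z (hasFDerivAt_normsq z)
  rw [show (fun x : E3 => β (‖x‖ ^ 2)) = β ∘ (fun x => ‖x‖ ^ 2) from rfl, this.fderiv]
  simp [EuclideanSpace.inner_single_right]

lemma contDiffOn_pder {f : E3 → ℝ} {s : Set E3} (hs : IsOpen s)
    (hf : ContDiffOn ℝ (⊤ : ℕ∞) f s) (i : Fin 3) : ContDiffOn ℝ (⊤ : ℕ∞) (pder i f) s := by
  have h1 : ContDiffOn ℝ (⊤ : ℕ∞) (fun x => fderiv ℝ f x) s :=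
    hf.fderiv_of_isOpen hs (by simp)
  exact h1.clm_apply contDiffOn_const

lemma ibp {f g : E3 → ℝ} (hf : ContDiffOn ℝ (⊤ : ℕ∞) f (pun 3)) (hg : ContDiff ℝ (⊤ : ℕ∞) g)
    (hs : tsupport g ⊆ ann) (i : Fin 3) :
    Integrable (fun z => f z * pder i g z + pder i f z * g z) ∧
      ∫ z, (f z * pder i g z + pder i f z * g z) = 0 := by
  have hpg : ContDiff ℝ (⊤ : ℕ∞) (pder i g) := by
    rw [← contDiffOn_univ]; exact contDiffOn_pder isOpen_univ hg.contDiffOn i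
  have hpf := contDiffOn_pder (isOpen_pun 3) hf i
  have g0 : ∀ z, z ∉ ann → g z = 0 := fun z hz => image_eq_zero_of_notMem_tsupport (fun h => hz (hs h))
  have pg0 : ∀ z, z ∉ ann → pder i g z = 0 := fun z hz => by
    unfold pder
    have : fderiv ℝ g z = 0 := by
      by_contra h
      exact hz (hs (support_fderiv_subset ℝ h))
    rw [this]; rfl
  have i1 : Integrable (fun z => pder i f z * g z) :=
    integrable_of_ann ((hpf.continuousOn.mono ann_subset).mul hg.continuous.continuousOn)
      (fun z hz => by simp [g0 z hz])
  have i2 : Integrable (fun z => f z * pder i g z) :=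
    integrable_of_ann ((hf.continuousOn.mono ann_subset).mul hpg.continuous.continuousOn)
      (fun z hz => by simp [pg0 z hz])
  have i3 : Integrable (fun z => f z * g z) :=
    integrable_of_ann ((hf.continuousOn.mono ann_subset).mul hg.continuous.continuousOn)
      (fun z hz => by simp [g0 z hz])
  refine ⟨i2.add i1, ?_⟩
  rw [integral_add i2 i1]
  have := integral_mul_fderiv_eq_neg_fderiv_mul_of_integrable (μ := (volume : Measure E3))
    (f := f) (g := g) (v := EuclideanSpace.single i 1) i1 i2 i3
    (fun x hx => (hf.contDiffAt ((isOpen_pun 3).mem_nhds (ann_subset (hs hx)))).differentiableAt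
      (by simp))
    (fun x _ => (hg.differentiable (by simp)) x)
  unfold pder
  linarith

/-- the left-hand integrand -/
def HH (F G : E3 → ℝ) (z : E3) : ℝ :=
  F z * lapl G z - (lapl F z - 6 * (∑ i : Fin 3, z i * pder i F z) / ‖z‖ ^ 2
    + 6 * F z / ‖z‖ ^ 2) * G z

def KK (F G : E3 → ℝ) (z : E3) : ℝ :=
  (∑ i : Fin 3, z i * (F z * pder i G z - G z * pder i F z)) + 3 * (F z * G z)

/-- properties of the radial cut-off -/
structure Cut (β : ℝ → ℝ) : Prop where
  smooth : ContDiff ℝ (⊤ : ℕ∞) β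
  supp : tsupport β ⊆ Set.Icc (3/2) (7/2)
  nonneg : ∀ t, 0 ≤ β t
  one : β (5/2) = 1

lemma exists_cut : ∃ β, Cut β := by
  let b : ContDiffBump (5/2 : ℝ) := ⟨1/2, 1, by norm_num, by norm_num⟩
  refine ⟨b, b.contDiff, ?_, fun t => b.nonneg, ?_⟩
  · rw [b.tsupport_eq, Real.closedBall_eq_Icc]
    intro x hx
    have h : b.rOut = 1 := rfl
    rw [h] at hx
    constructor <;> linarith [hx.1, hx.2]
  · exact b.one_of_mem_closedBall (by simp [b])

lemma mem_ann_of {z : E3} (h : ‖z‖ ^ 2 ∈ Set.Icc (3/2 : ℝ) (7/2)) : z ∈ ann := by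
  constructor
  · nlinarith [h.1, norm_nonneg z]
  · nlinarith [h.2, norm_nonneg z]

lemma Cut.zero {β : ℝ → ℝ} (h : Cut β) {z : E3} (hz : z ∉ ann) : β (‖z‖ ^ 2) = 0 :=
  image_eq_zero_of_notMem_tsupport (fun h' => hz (mem_ann_of (h.supp h')))

lemma Cut.dzero {β : ℝ → ℝ} (h : Cut β) {z : E3} (hz : z ∉ ann) : deriv β (‖z‖ ^ 2) = 0 := by
  by_contra h'
  exact hz (mem_ann_of (h.supp (support_deriv_subset h')))

lemma Cut.tsupp {β : ℝ → ℝ} (h : Cut β) : tsupport (fun z : E3 => β (‖z‖ ^ 2)) ⊆ ann := by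
  refine closure_minimal ?_ isClosed_ann
  intro z hz
  by_contra h'
  exact hz (h.zero h')

def th (β : ℝ → ℝ) (z : E3) : ℝ := ‖z‖ ^ 2 * β (‖z‖ ^ 2)
def ww (β : ℝ → ℝ) (z : E3) : ℝ := 5 * β (‖z‖ ^ 2) + 2 * ‖z‖ ^ 2 * deriv β (‖z‖ ^ 2)

lemma contDiff_normsq : ContDiff ℝ (⊤ : ℕ∞) (fun z : E3 => ‖z‖ ^ 2) := contDiff_norm_sq ℝ

lemma main_ibp {β : ℝ → ℝ} (hb : Cut β) {F G : E3 → ℝ}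
    (hF : ContDiffOn ℝ (⊤ : ℕ∞) F (pun 3)) (hG : ContDiffOn ℝ (⊤ : ℕ∞) G (pun 3)) :
    ∫ z, (th β z * HH F G z + ww β z * KK F G z) = 0 := by
  have hu : ContDiff ℝ (⊤ : ℕ∞) (fun z : E3 => β (‖z‖ ^ 2)) := hb.smooth.comp contDiff_normsq
  have hth : ContDiff ℝ (⊤ : ℕ∞) (th β) := contDiff_normsq.mul hu
  have sth : tsupport (th β) ⊆ ann := by
    refine closure_minimal ?_ isClosed_ann
    intro z hz
    by_contra h'
    exact hz (by simp [th, hb.zero h'])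
  have hpF := fun i => contDiffOn_pder (isOpen_pun 3) hF i
  have hpG := fun i => contDiffOn_pder (isOpen_pun 3) hG i
  have A := fun i => ibp (((hF.mul (hpG i)).sub (hG.mul (hpF i)))) hth sth i
  have hco : ∀ i : Fin 3, ContDiff ℝ (⊤ : ℕ∞) (fun z : E3 => z i) := fun i =>
    (EuclideanSpace.proj i : E3 →L[ℝ] ℝ).contDiff
  have B := fun i => ibp ((hco i).contDiffOn.mul (hF.mul hG)) hu hb.tsupp i
  have e : ∀ z, (th β z * HH F G z + ww β z * KK F G z) = ∑ i : Fin 3,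
      (((F z * pder i G z - G z * pder i F z) * pder i (th β) z +
          pder i (fun z => F z * pder i G z - G z * pder i F z) z * th β z) +
       3 * ((z i * (F z * G z)) * pder i (fun z : E3 => β (‖z‖ ^ 2)) z +
          pder i (fun z => z i * (F z * G z)) z * β (‖z‖ ^ 2))) := by
    intro z
    have p1 : ∀ i, pder i (th β) z = ‖z‖ ^ 2 * (deriv β (‖z‖ ^ 2) * (2 * z i))
        + β (‖z‖ ^ 2) * (2 * z i) := fun i => by
      unfold th
      rw [pder_mul i (hasFDerivAt_normsq z).differentiableAt (hu.differentiable (by simp) z),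
        pder_radial hb.smooth, pder_normsq]
    by_cases hz : z ∈ ann
    · have nb := (isOpen_pun 3).mem_nhds (ann_subset hz)
      have dF : DifferentiableAt ℝ F z := (hF.contDiffAt nb).differentiableAt (by simp)
      have dG : DifferentiableAt ℝ G z := (hG.contDiffAt nb).differentiableAt (by simp)
      have dpF := fun i => ((hpF i).contDiffAt nb).differentiableAt (by simp)
      have dpG := fun i => ((hpG i).contDiffAt nb).differentiableAt (by simp)
      have p2 : ∀ i, pder i (fun z => F z * pder i G z - G z * pder i F z) z =
          F z * pder i (pder i G) z - G z * pder i (pder i F) z := fun i => by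
        rw [pder_sub i (dF.fun_mul (dpG i)) (dG.fun_mul (dpF i)), pder_mul i dF (dpG i),
          pder_mul i dG (dpF i)]
        ring
      have p3 : ∀ i, pder i (fun z => z i * (F z * G z)) z =
          z i * (F z * pder i G z + G z * pder i F z) + F z * G z := fun i => by
        rw [pder_mul i ((hco i).differentiable (by simp) z) (dF.fun_mul dG), pder_mul i dF dG,
          pder_coord]
        ring
      simp only [p1, p2, p3, pder_radial hb.smooth]
      have hz0 : ‖z‖ ^ 2 ≠ 0 := by have := hz.1; positivity
      have hn : ‖z‖ ^ 2 = z 0 ^ 2 + z 1 ^ 2 + z 2 ^ 2 := by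
        rw [EuclideanSpace.norm_sq_eq]; simp [Fin.sum_univ_three]
      simp only [th, ww, HH, KK, lapl, Fin.sum_univ_three]
      generalize β (‖z‖ ^ 2) = b
      generalize deriv β (‖z‖ ^ 2) = b'
      generalize ‖z‖ ^ 2 = ρ at *
      field_simp
      rw [hn]
      ring
    · simp [p1, th, ww, hb.zero hz, hb.dzero hz, pder_radial hb.smooth]
  simp_rw [e]
  rw [integral_finsetSum]
  · refine Finset.sum_eq_zero fun i _ => ?_
    rw [integral_add (A i).1 ((B i).1.const_mul 3), integral_const_mul]
    rw [(A i).2, (B i).2]; simp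
  · intro i _
    exact (A i).1.add ((B i).1.const_mul 3)

lemma polar (f : ℝ → ℝ) (c : E3 → ℝ) :
    ∫ z : E3, f ‖z‖ * c (‖z‖⁻¹ • z) =
      (∫ t in Set.Ioi (0 : ℝ), t ^ 2 * f t) * ∫ n : S2, c n ∂dOmega := by
  have hd : Module.finrank ℝ E3 = 3 := by simp
  calc
    ∫ z : E3, f ‖z‖ * c (‖z‖⁻¹ • z)
      = ∫ x : ({(0 : E3)}ᶜ : Set E3), f ‖x.1‖ * c (‖x.1‖⁻¹ • x.1)
          ∂((volume : Measure E3).comap (↑)) := by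
      rw [integral_subtype_comap (measurableSet_singleton _).compl
        fun x : E3 ↦ f (‖x‖) * c (‖x‖⁻¹ • x), restrict_compl_singleton]
    _ = ∫ x : S2 × Set.Ioi (0 : ℝ), c x.1 * f x.2
          ∂(volume : Measure E3).toSphere.prod (.volumeIoiPow (Module.finrank ℝ E3 - 1)) := by
      have := (volume : Measure E3).measurePreserving_homeomorphUnitSphereProd.integral_comp
        (Homeomorph.measurableEmbedding _)
        (fun x : S2 × Set.Ioi (0 : ℝ) => c x.1 * f x.2)
      rw [← this]
      refine integral_congr_ae (Eventually.of_forall fun x => ?_)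
      simp [mul_comm]
    _ = (∫ n : S2, c n ∂(volume : Measure E3).toSphere) *
          ∫ x : Set.Ioi (0 : ℝ), f x ∂.volumeIoiPow (Module.finrank ℝ E3 - 1) :=
      integral_prod_mul (fun n : S2 => c n) (fun x : Set.Ioi (0 : ℝ) => f x)
    _ = _ := by
      rw [mul_comm, hd]
      congr 1
      simp only [Measure.volumeIoiPow, ENNReal.ofReal]
      rw [integral_withDensity_eq_integral_smul,
        integral_subtype_comap measurableSet_Ioi fun a ↦ Real.toNNReal (a ^ (3 - 1)) • f a,
        setIntegral_congr_fun measurableSet_Ioi fun x hx ↦ ?_]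
      · rw [NNReal.smul_def, Real.coe_toNNReal _ (pow_nonneg hx.out.le _)]; rfl
      · exact (measurable_subtype_coe.pow_const _).real_toNNReal

def lsum (l : List (ℝ × ℝ)) (t : ℝ) : ℝ := (l.map fun p => p.2 * t ^ p.1).sum

lemma lsum_append (l l' : List (ℝ × ℝ)) (t : ℝ) : lsum (l ++ l') t = lsum l t + lsum l' t := by
  simp [lsum]

lemma lsum_unique (n : ℕ) : ∀ (l : List (ℝ × ℝ)) (L : ℝ), l.length = n → (∀ p ∈ l, p.1 ≠ 0) →
    Tendsto (lsum l) (𝓝[>] 0) (𝓝 L) → L = 0 := by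
  induction n with
  | zero =>
    intro l L hl _ h
    have : l = [] := List.length_eq_zero_iff.mp hl
    subst this
    have h' : Tendsto (fun _ : ℝ => (0 : ℝ)) (𝓝[>] 0) (𝓝 L) := h.congr (fun t => by simp [lsum])
    exact tendsto_nhds_unique h' tendsto_const_nhds
  | succ n ih =>
    intro l L hl hne h
    obtain _ | ⟨⟨a, k⟩, l⟩ := l
    · simp at hl
    have ha : a ≠ 0 := hne (a, k) (by simp)
    let l' : List (ℝ × ℝ) := l.map fun p => (p.1, (2 ^ p.1 - 2 ^ a) * p.2)
    have h2 : Tendsto (fun t : ℝ => 2 * t) (𝓝[>] 0) (𝓝[>] 0) := by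
      refine tendsto_nhdsWithin_iff.mpr ⟨?_, ?_⟩
      · have : Tendsto (fun t : ℝ => 2 * t) (𝓝 0) (𝓝 (2 * 0)) := (continuous_const_mul 2).tendsto 0
        rw [mul_zero] at this
        exact this.mono_left nhdsWithin_le_nhds
      · filter_upwards [self_mem_nhdsWithin] with t ht
        have : (0 : ℝ) < t := ht
        simpa using this
    have h3 := (h.comp h2).sub (h.const_mul ((2 : ℝ) ^ a))
    have key : ∀ t : ℝ, 0 < t → ∀ m : List (ℝ × ℝ), lsum m (2 * t) - 2 ^ a * lsum m t =
        lsum (m.map fun p => (p.1, (2 ^ p.1 - 2 ^ a) * p.2)) t := by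
      intro t ht m
      induction m with
      | nil => simp [lsum]
      | cons p m ihm =>
        simp only [lsum, List.map_cons, List.sum_cons] at ihm ⊢
        rw [← ihm, Real.mul_rpow (by norm_num) ht.le]
        ring
    have h4 : Tendsto (lsum l') (𝓝[>] 0) (𝓝 (L - 2 ^ a * L)) := by
      refine h3.congr' ?_
      filter_upwards [self_mem_nhdsWithin] with t ht
      have := key t ht ((a, k) :: l)
      simp only [Function.comp_apply]
      rw [this]
      simp [lsum, l']
    have h5 := ih l' _ (by simpa [l'] using hl) (by
      intro p hp
      simp only [l', List.mem_map] at hp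
      obtain ⟨q, hq, rfl⟩ := hp
      exact hne q (by simp [hq])) h4
    have h6 : (1 - (2 : ℝ) ^ a) * L = 0 := by linarith
    rcases mul_eq_zero.mp h6 with h7 | h7
    · exfalso
      have h8 : (2 : ℝ) ^ a = 2 ^ (0 : ℝ) := by rw [Real.rpow_zero]; linarith
      have := (Real.strictMono_rpow_of_base_gt_one (by norm_num : (1 : ℝ) < 2)).injective h8
      exact ha this
    · exact h7

inductive PS (P : ℝ → Prop) : (E3 → ℝ) → Prop
  | zero : PS P (fun _ => 0)
  | mono (a : ℝ) (c : E3 → ℝ) (ha : P a) (hc : Continuous c) :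
      PS P (fun z => ‖z‖ ^ a * c (‖z‖⁻¹ • z))
  | add {f g : E3 → ℝ} (hf : PS P f) (hg : PS P g) : PS P (fun z => f z + g z)

lemma PS.weaken {P Q : ℝ → Prop} (h : ∀ a, P a → Q a) {f : E3 → ℝ} (hf : PS P f) : PS Q f := by
  induction hf with
  | zero => exact .zero
  | mono a c ha hc => exact .mono a c (h a ha) hc
  | add _ _ h1 h2 => exact .add h1 h2

lemma PS.const_mul {P : ℝ → Prop} {f : E3 → ℝ} (hf : PS P f) (k : ℝ) :
    PS P (fun z => k * f z) := by
  induction hf with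
  | zero => simpa using PS.zero
  | mono a c ha hc =>
    have := PS.mono a (fun z => k * c z) ha (hc.const_mul k)
    convert this using 2
    ring
  | add _ _ h1 h2 =>
    convert PS.add h1 h2 using 2
    ring

lemma PS.shift {P : ℝ → Prop} {f : E3 → ℝ} (hf : PS P f) (b : ℝ) :
    ∃ g, PS (fun a => P (a + b)) g ∧ ∀ z : E3, z ≠ 0 → g z = ‖z‖ ^ (-b) * f z := by
  induction hf with
  | zero => exact ⟨_, .zero, by simp⟩
  | mono a c ha hc =>
    refine ⟨_, .mono (a - b) c (by simpa using ha) hc, fun z hz => ?_⟩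
    rw [← mul_assoc, ← Real.rpow_add (norm_pos_iff.mpr hz)]
    congr 2
    ring
  | add _ _ h1 h2 =>
    obtain ⟨g1, hg1, e1⟩ := h1
    obtain ⟨g2, hg2, e2⟩ := h2
    refine ⟨_, .add hg1 hg2, fun z hz => ?_⟩
    rw [e1 z hz, e2 z hz]; ring

abbrev PT : ℝ → Prop := fun _ => True

/-- equality of functions away from the origin; products of power sums -/
lemma PS.mul {f g : E3 → ℝ} (hf : PS PT f) (hg : PS PT g) :
    ∃ h, PS PT h ∧ ∀ z : E3, z ≠ 0 → h z = f z * g z := by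
  induction hf with
  | zero => exact ⟨_, .zero, by simp⟩
  | mono a c ha hc =>
    induction hg with
    | zero => exact ⟨_, .zero, by simp⟩
    | mono b d hb hd =>
      refine ⟨_, .mono (a + b) (fun z => c z * d z) trivial (hc.mul hd), fun z hz => ?_⟩
      rw [Real.rpow_add (norm_pos_iff.mpr hz)]; ring
    | add _ _ h1 h2 =>
      obtain ⟨g1, hg1, e1⟩ := h1
      obtain ⟨g2, hg2, e2⟩ := h2
      refine ⟨_, .add hg1 hg2, fun z hz => ?_⟩
      rw [e1 z hz, e2 z hz]; ring
  | add _ _ h1 h2 =>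
    obtain ⟨g1, hg1, e1⟩ := h1
    obtain ⟨g2, hg2, e2⟩ := h2
    refine ⟨_, .add hg1 hg2, fun z hz => ?_⟩
    rw [e1 z hz, e2 z hz]; ring

lemma cont_dir : ContinuousOn (fun z : E3 => ‖z‖⁻¹ • z) {z | z ≠ 0} := by
  refine ContinuousOn.smul (continuous_norm.continuousOn.inv₀ ?_) continuousOn_id
  intro z hz
  simpa using hz

lemma PS.cont {P : ℝ → Prop} {f : E3 → ℝ} (hf : PS P f) : ContinuousOn f {z | z ≠ 0} := by
  induction hf with
  | zero => exact continuousOn_const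
  | mono a c ha hc =>
    refine ContinuousOn.mul ?_ (hc.comp_continuousOn cont_dir)
    refine continuous_norm.continuousOn.rpow_const ?_
    intro z hz
    left
    simpa using hz
  | add _ _ h1 h2 => exact h1.add h2

lemma norm_dir {z : E3} (hz : z ≠ 0) : ‖‖z‖⁻¹ • z‖ = 1 := by
  rw [norm_smul, norm_inv, norm_norm, inv_mul_cancel₀ (norm_ne_zero_iff.mpr hz)]

lemma PS.bound {P : ℝ → Prop} {f : E3 → ℝ} (hf : PS P f) :
    ∃ M : ℕ, ∃ C : ℝ, 0 ≤ C ∧ ∀ z : E3, z ≠ 0 → ‖z‖ ≤ 1 → |f z| * ‖z‖ ^ M ≤ C := by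
  induction hf with
  | zero => exact ⟨0, 0, le_rfl, by simp⟩
  | mono a c ha hc =>
    obtain ⟨M, hM⟩ := exists_nat_ge (-a)
    obtain ⟨C, hC⟩ := (isCompact_sphere (0 : E3) 1).exists_bound_of_continuousOn hc.continuousOn
    refine ⟨M, |C|, abs_nonneg _, fun z hz h1 => ?_⟩
    have hp := norm_pos_iff.mpr hz
    have h2 := hC (‖z‖⁻¹ • z) (by simpa using norm_dir hz)
    rw [Real.norm_eq_abs] at h2
    have h3 : ‖z‖ ^ a * ‖z‖ ^ M ≤ 1 := by
      rw [← Real.rpow_natCast, ← Real.rpow_add hp]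
      exact Real.rpow_le_one hp.le h1 (by linarith)
    rw [abs_mul, abs_of_nonneg (Real.rpow_nonneg hp.le a)]
    calc ‖z‖ ^ a * |c (‖z‖⁻¹ • z)| * ‖z‖ ^ M = (‖z‖ ^ a * ‖z‖ ^ M) * |c (‖z‖⁻¹ • z)| := by ring
      _ ≤ 1 * |C| := by
        refine mul_le_mul h3 (h2.trans (le_abs_self C)) (abs_nonneg _) zero_le_one
      _ = |C| := one_mul _
  | @add f g _ _ h1 h2 =>
    obtain ⟨M1, C1, p1, b1⟩ := h1
    obtain ⟨M2, C2, p2, b2⟩ := h2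
    refine ⟨M1 + M2, C1 + C2, by positivity, fun z hz hz1 => ?_⟩
    have q1 : ‖z‖ ^ M1 ≤ 1 := pow_le_one₀ (norm_nonneg _) hz1
    have q2 : ‖z‖ ^ M2 ≤ 1 := pow_le_one₀ (norm_nonneg _) hz1
    have r1 : |f z| * ‖z‖ ^ M1 * ‖z‖ ^ M2 ≤ C1 * 1 :=
      mul_le_mul (b1 z hz hz1) q2 (by positivity) p1
    have r2 : |g z| * ‖z‖ ^ M2 * ‖z‖ ^ M1 ≤ C2 * 1 :=
      mul_le_mul (b2 z hz hz1) q1 (by positivity) p2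
    have : |f z + g z| * ‖z‖ ^ (M1 + M2) ≤ (|f z| + |g z|) * ‖z‖ ^ (M1 + M2) := by
      gcongr; exact abs_add_le _ _
    refine this.trans ?_
    rw [pow_add]
    nlinarith

def Ex (f : E3 → ℝ) : Prop := ∀ N : ℕ, ∃ g, PS PT g ∧ ∃ C, 0 ≤ C ∧ ∃ δ > 0, ∀ z : E3, z ≠ 0 →
  ‖z‖ < δ → |f z - g z| ≤ C * ‖z‖ ^ N

lemma Ex.congr {f g : E3 → ℝ} (hf : Ex f) (h : ∀ z, z ≠ 0 → f z = g z) : Ex g := by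
  intro N
  obtain ⟨u, hu, C, hC, δ, hδ, H⟩ := hf N
  exact ⟨u, hu, C, hC, δ, hδ, fun z hz hz' => by rw [← h z hz]; exact H z hz hz'⟩

lemma Ex.of_PS {f : E3 → ℝ} (hf : PS PT f) : Ex f := fun N =>
  ⟨f, hf, 0, le_rfl, 1, one_pos, by simp⟩

lemma Ex.add {f g : E3 → ℝ} (hf : Ex f) (hg : Ex g) : Ex (fun z => f z + g z) := by
  intro N
  obtain ⟨u, hu, C, hC, δ, hδ, H⟩ := hf N
  obtain ⟨u', hu', C', hC', δ', hδ', H'⟩ := hg N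
  refine ⟨_, hu.add hu', C + C', by positivity, min δ δ', lt_min hδ hδ', fun z hz hz' => ?_⟩
  have h1 := H z hz (hz'.trans_le (min_le_left _ _))
  have h2 := H' z hz (hz'.trans_le (min_le_right _ _))
  calc |f z + g z - (u z + u' z)| = |(f z - u z) + (g z - u' z)| := by ring_nf
    _ ≤ _ := (abs_add_le _ _).trans (by linarith)

lemma Ex.mul {f g : E3 → ℝ} (hf : Ex f) (hg : Ex g) : Ex (fun z => f z * g z) := by
  intro N
  obtain ⟨u0, hu0, C0, hC0, δ0, hδ0, H0⟩ := hf 0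
  obtain ⟨M1, B1, hB1, b1⟩ := hu0.bound
  obtain ⟨v, hv, C2, hC2, δ2, hδ2, H2⟩ := hg (N + M1)
  obtain ⟨M2, B2, hB2, b2⟩ := hv.bound
  obtain ⟨u, hu, C1, hC1, δ1, hδ1, H1⟩ := hf (N + M2)
  obtain ⟨h, hh, eh⟩ := hu.mul hv
  refine ⟨h, hh, (B1 + C0) * C2 + C1 * B2, by positivity, min (min δ0 1) (min δ1 δ2),
    by positivity, fun z hz hz' => ?_⟩
  simp only [lt_min_iff] at hz'
  obtain ⟨⟨z0, z1⟩, z2, z3⟩ := hz'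
  rw [eh z hz]
  have k0 := H0 z hz z0
  rw [pow_zero, mul_one] at k0
  have k1 := H1 z hz z2
  have k2 := H2 z hz z3
  have k3 := b1 z hz z1.le
  have k4 := b2 z hz z1.le
  have q1 : ‖z‖ ^ M1 ≤ 1 := pow_le_one₀ (norm_nonneg _) z1.le
  have k5 : |f z| * ‖z‖ ^ M1 ≤ B1 + C0 := by
    have : |f z| ≤ |u0 z| + C0 := by
      have := abs_add_le (u0 z) (f z - u0 z)
      rw [add_sub_cancel] at this
      linarith
    calc |f z| * ‖z‖ ^ M1 ≤ (|u0 z| + C0) * ‖z‖ ^ M1 := by gcongr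
      _ = |u0 z| * ‖z‖ ^ M1 + C0 * ‖z‖ ^ M1 := by ring
      _ ≤ B1 + C0 * 1 := by gcongr
      _ = _ := by ring
  calc |f z * g z - u z * v z| = |f z * (g z - v z) + (f z - u z) * v z| := by ring_nf
    _ ≤ |f z| * |g z - v z| + |f z - u z| * |v z| := by
      rw [← abs_mul, ← abs_mul]; exact abs_add_le _ _
    _ ≤ |f z| * (C2 * ‖z‖ ^ (N + M1)) + (C1 * ‖z‖ ^ (N + M2)) * |v z| := by gcongr
    _ = (|f z| * ‖z‖ ^ M1) * (C2 * ‖z‖ ^ N) + (C1 * ‖z‖ ^ N) * (|v z| * ‖z‖ ^ M2) := by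
      rw [pow_add, pow_add]; ring
    _ ≤ (B1 + C0) * (C2 * ‖z‖ ^ N) + (C1 * ‖z‖ ^ N) * B2 := by gcongr
    _ = _ := by ring

lemma Ex.const (k : ℝ) : Ex (fun _ => k) := by
  refine (Ex.of_PS (PS.mono 0 (fun _ => k) trivial continuous_const)).congr fun z hz => ?_
  simp

lemma Ex.normsq : Ex (fun z => ‖z‖ ^ 2) := by
  refine (Ex.of_PS (PS.mono 2 (fun _ => 1) trivial continuous_const)).congr fun z hz => ?_
  simp

lemma Ex.coord (i : Fin 3) : Ex (fun z => z i) := by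
  refine (Ex.of_PS (PS.mono 1 (fun z => z i) trivial
    (EuclideanSpace.proj i : E3 →L[ℝ] ℝ).continuous)).congr fun z hz => ?_
  have := norm_ne_zero_iff.mpr hz
  simp [this]

lemma Ex.KK {F G : E3 → ℝ} (hF : Ex F) (hG : Ex G) (hpF : ∀ i, Ex (pder i F))
    (hpG : ∀ i, Ex (pder i G)) : Ex (KK F G) := by
  have T : ∀ i, Ex (fun z => z i * (F z * pder i G z + (-1) * (G z * pder i F z))) := fun i =>
    (Ex.coord i).mul ((hF.mul (hpG i)).add ((Ex.const (-1)).mul (hG.mul (hpF i))))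
  refine ((((T 0).add (T 1)).add (T 2)).add ((Ex.const 3).mul (hF.mul hG))).congr fun z _ => ?_
  simp only [PfAux.KK, Fin.sum_univ_three]
  ring

lemma sing_split {F : E3 → ℝ} {c : ℝ → S2 → ℝ} (h : HasSingExpansion 0 F c) (N : ℕ) :
    ∃ (g c0 : E3 → ℝ), PS (fun a => a ≠ (N : ℝ)) g ∧ Continuous c0 ∧ (∀ n : S2, c0 n = c N n) ∧
      ∀ ε > 0, ∃ δ > 0, ∀ z : E3, z ≠ 0 → ‖z‖ < δ →
        |F z - g z - ‖z‖ ^ N * c0 (‖z‖⁻¹ • z)| ≤ ε * ‖z‖ ^ N := by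
  choose e he1 he2 using h.smooth_coeffs
  let S := (h.finite_exponents N).toFinset
  have hps : ∀ T : Finset ℝ, (∀ a ∈ T, a ≠ (N : ℝ)) →
      PS (fun a => a ≠ (N : ℝ)) (fun z => ∑ a ∈ T, ‖z‖ ^ a * e a (‖z‖⁻¹ • z)) := by
    intro T
    induction T using Finset.induction_on with
    | empty => intro _; simpa using PS.zero
    | insert a T ha ih =>
      intro hT
      have h1 := PS.add (PS.mono (P := fun a => a ≠ (N : ℝ)) a (e a) (hT a (by simp))
        (he1 a).continuous) (ih fun b hb => hT b (by simp [hb]))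
      convert h1 using 2
      rw [Finset.sum_insert ha]
  refine ⟨_, e N, hps (S.erase (N : ℝ)) (fun a ha => Finset.ne_of_mem_erase ha),
    (he1 N).continuous, he2 N, fun ε hε => ?_⟩
  obtain ⟨δ, hδ, H⟩ := h.expansion N ε hε
  refine ⟨δ, hδ, fun z hz hzδ => ?_⟩
  have h1 := H ‖z‖ (norm_pos_iff.mpr hz) hzδ ⟨‖z‖⁻¹ • z, by simpa using norm_dir hz⟩
  have h2 : ‖z‖ • (‖z‖⁻¹ • z) = z := smul_inv_smul₀ (norm_ne_zero_iff.mpr hz) z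
  simp only [zero_add, h2, Real.rpow_natCast] at h1
  set n : S2 := ⟨‖z‖⁻¹ • z, by simpa using norm_dir hz⟩ with hn
  have h3 : ∑ᶠ (a : ℝ) (_ : a ≤ (N : ℝ)), ‖z‖ ^ a * c a n = ∑ a ∈ S, ‖z‖ ^ a * c a n := by
    rw [← finsum_mem_coe_finset]
    refine finsum_congr fun a => ?_
    by_cases ha : a ≤ (N : ℝ)
    · by_cases hc : c a = 0
      · have : c a n = 0 := by rw [hc]; rfl
        simp [this]
      · have : a ∈ (S : Set ℝ) := by simp [S, ha, hc]
        simp [ha, this]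
    · have : a ∉ (S : Set ℝ) := by simp [S, ha]
      simp [ha, this]
  have h4 : ∑ a ∈ S, ‖z‖ ^ a * c a n =
      ∑ a ∈ S.erase (N : ℝ), ‖z‖ ^ a * e a (‖z‖⁻¹ • z) + ‖z‖ ^ N * e N (‖z‖⁻¹ • z) := by
    have e' : ∀ a, e a (‖z‖⁻¹ • z) = c a n := fun a => he2 a n
    simp only [e']
    by_cases hN : (N : ℝ) ∈ S
    · rw [← Finset.sum_erase_add _ _ hN, Real.rpow_natCast]
    · have : c N = 0 := by
        by_contra hc
        exact hN (by simp [S, hc])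
      rw [Finset.erase_eq_of_notMem hN, this]
      simp
  rw [h3, h4] at h1
  rwa [sub_sub]

lemma Ex.of_sing {F : E3 → ℝ} {c : ℝ → S2 → ℝ} (h : HasSingExpansion 0 F c) : Ex F := by
  intro N
  obtain ⟨g, c0, hg, hc, _, H⟩ := sing_split h N
  obtain ⟨δ, hδ, H⟩ := H 1 one_pos
  refine ⟨_, (hg.weaken fun _ _ => trivial).add (PS.mono N c0 trivial hc), 1, zero_le_one, δ, hδ,
    fun z hz hz' => ?_⟩
  have := H z hz hz'
  rwa [Real.rpow_natCast, ← sub_sub]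

def PfLim (f : E3 → ℝ) (L : ℝ) : Prop :=
  ∃ (g c0 : E3 → ℝ), PS (fun a => a ≠ 0) g ∧ Continuous c0 ∧ L = ∫ n : S2, c0 n ∂dOmega ∧
    ∀ ε > 0, ∃ δ > 0, ∀ z : E3, z ≠ 0 → ‖z‖ < δ → |f z - g z - c0 (‖z‖⁻¹ • z)| ≤ ε

lemma PfLim.congr {f g : E3 → ℝ} {L : ℝ} (hf : PfLim f L) (h : ∀ z, z ≠ 0 → f z = g z) :
    PfLim g L := by
  obtain ⟨u, c, hu, hc, hL, H⟩ := hf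
  refine ⟨u, c, hu, hc, hL, fun ε hε => ?_⟩
  obtain ⟨δ, hδ, H⟩ := H ε hε
  exact ⟨δ, hδ, fun z hz hz' => by rw [← h z hz]; exact H z hz hz'⟩

instance : IsFiniteMeasure dOmega := by unfold dOmega; infer_instance

lemma int_sphere {c : E3 → ℝ} (hc : Continuous c) : Integrable (fun n : S2 => c n) dOmega :=
  (hc.comp continuous_subtype_val).integrable_of_hasCompactSupport
    (HasCompactSupport.of_compactSpace _)

lemma PfLim.add_mul {f g : E3 → ℝ} {L M : ℝ} (hf : PfLim f L) (hg : PfLim g M) (k : ℝ) :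
    PfLim (fun z => f z + k * g z) (L + k * M) := by
  obtain ⟨u, c, hu, hc, hL, H⟩ := hf
  obtain ⟨u', c', hu', hc', hL', H'⟩ := hg
  refine ⟨_, fun z => c z + k * c' z, hu.add (hu'.const_mul k), hc.add (hc'.const_mul k), ?_,
    fun ε hε => ?_⟩
  · rw [integral_add (int_sphere hc) ((int_sphere hc').const_mul k), integral_const_mul, hL, hL']
  · obtain ⟨δ, hδ, H⟩ := H (ε / 2) (by positivity)
    obtain ⟨δ', hδ', H'⟩ := H' (ε / 2 / (|k| + 1)) (by positivity)
    refine ⟨min δ δ', lt_min hδ hδ', fun z hz hz' => ?_⟩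
    have h1 := H z hz (hz'.trans_le (min_le_left _ _))
    have h2 := H' z hz (hz'.trans_le (min_le_right _ _))
    rw [le_div_iff₀ (by positivity)] at h2
    calc _ = |(f z - u z - c (‖z‖⁻¹ • z)) + k * (g z - u' z - c' (‖z‖⁻¹ • z))| := by ring_nf
      _ ≤ ε / 2 + |k| * |g z - u' z - c' (‖z‖⁻¹ • z)| := by
        refine (abs_add_le _ _).trans ?_
        rw [abs_mul]; gcongr
      _ ≤ ε := by
        have := abs_nonneg (g z - u' z - c' (‖z‖⁻¹ • z))
        nlinarith

lemma PfLim.zero : PfLim (fun _ => 0) 0 :=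
  ⟨_, fun _ => 0, .zero, continuous_const, by simp, fun ε hε => ⟨1, one_pos, by simp [hε.le]⟩⟩

lemma PfLim.of_sing {F : E3 → ℝ} {c : ℝ → S2 → ℝ} (h : HasSingExpansion 0 F c) (N : ℕ) :
    PfLim (fun z => F z / ‖z‖ ^ N) (∫ n, c N n ∂dOmega) := by
  obtain ⟨g, c0, hg, hc, hcc, H⟩ := sing_split h N
  obtain ⟨g', hg', e⟩ := hg.shift N
  refine ⟨g', c0, hg'.weaken (fun a ha => by simpa using ha), hc, by simp [hcc], fun ε hε => ?_⟩
  obtain ⟨δ, hδ, H⟩ := H ε hε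
  refine ⟨δ, hδ, fun z hz hz' => ?_⟩
  have hp := norm_pos_iff.mpr hz
  have h1 := H z hz hz'
  rw [e z hz, Real.rpow_neg hp.le, Real.rpow_natCast]
  have hp' : 0 < ‖z‖ ^ N := by positivity
  have : F z / ‖z‖ ^ N - (‖z‖ ^ N)⁻¹ * g z - c0 (‖z‖⁻¹ • z)
      = (F z - g z - ‖z‖ ^ N * c0 (‖z‖⁻¹ • z)) / ‖z‖ ^ N := by field_simp
  rw [this, abs_div, abs_of_pos hp', div_le_iff₀ hp']
  exact h1

/-- a continuous radial weight supported in the annulus -/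
structure RW (w : E3 → ℝ) (ω : ℝ → ℝ) : Prop where
  cont : Continuous w
  rad : ∀ z, w z = ω ‖z‖
  zero : ∀ z, z ∉ ann → w z = 0

lemma RW.integrable {w : E3 → ℝ} {ω : ℝ → ℝ} (hw : RW w ω) {f : E3 → ℝ}
    (hf : ContinuousOn f ann) : Integrable (fun z => w z * f z) :=
  integrable_of_ann (hw.cont.continuousOn.mul hf) (fun z hz => by simp [hw.zero z hz])

lemma ne_zero_of_ann {z : E3} (hz : z ∈ ann) : z ≠ 0 :=
  norm_pos_iff.mp (by linarith [hz.1])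

lemma PS.cont_scale {P : ℝ → Prop} {g : E3 → ℝ} (hg : PS P g) {t : ℝ} (ht : 0 < t) :
    ContinuousOn (fun z => g (t • z)) ann :=
  hg.cont.comp (continuous_const_smul t).continuousOn
    (fun z hz => smul_ne_zero ht.ne' (ne_zero_of_ann hz))

lemma M_PS {P : ℝ → Prop} {g : E3 → ℝ} (hg : PS P g) {w : E3 → ℝ} {ω : ℝ → ℝ} (hw : RW w ω)
    (e : ℝ) (hv : P e → ∫ t in Set.Ioi (0 : ℝ), t ^ 2 * (ω t * t ^ e) = 0) :
    ∃ l : List (ℝ × ℝ), (∀ p ∈ l, p.1 ≠ e) ∧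
      ∀ t : ℝ, 0 < t → ∫ z, w z * g (t • z) = lsum l t := by
  induction hg with
  | zero => exact ⟨[], by simp, by simp [lsum]⟩
  | mono a c ha hc =>
    have key : ∀ t : ℝ, 0 < t → ∫ z, w z * (‖t • z‖ ^ a * c (‖t • z‖⁻¹ • t • z)) =
        t ^ a * ((∫ s in Set.Ioi (0 : ℝ), s ^ 2 * (ω s * s ^ a)) * ∫ n : S2, c n ∂dOmega) := by
      intro t ht
      rw [← polar (fun s => ω s * s ^ a) c, ← integral_const_mul]
      refine integral_congr_ae (Eventually.of_forall fun z => ?_)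
      have e1 : ‖t • z‖ = t * ‖z‖ := by rw [norm_smul, Real.norm_of_nonneg ht.le]
      have e2 : (t * ‖z‖)⁻¹ • t • z = ‖z‖⁻¹ • z := by
        rw [smul_smul, mul_inv, mul_right_comm, inv_mul_cancel₀ ht.ne', one_mul]
      simp only [e1, e2, hw.rad]
      rw [Real.mul_rpow ht.le (norm_nonneg z)]
      ring
    by_cases hae : a = e
    · subst hae
      exact ⟨[], by simp, fun t ht => by rw [key t ht, hv ha]; simp [lsum]⟩
    · refine ⟨[(a, (∫ s in Set.Ioi (0 : ℝ), s ^ 2 * (ω s * s ^ a)) * ∫ n : S2, c n ∂dOmega)],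
        by simpa using hae, fun t ht => ?_⟩
      rw [key t ht, mul_comm]
      simp only [lsum, List.map_cons, List.map_nil, List.sum_cons, List.sum_nil, add_zero]
  | @add f g hf hg h1 h2 =>
    obtain ⟨l1, n1, e1⟩ := h1
    obtain ⟨l2, n2, e2⟩ := h2
    refine ⟨l1 ++ l2, ?_, fun t ht => ?_⟩
    · intro p hp
      rcases List.mem_append.mp hp with h | h
      exacts [n1 p h, n2 p h]
    · rw [lsum_append, ← e1 t ht, ← e2 t ht,
        ← integral_add (hw.integrable (hf.cont_scale ht)) (hw.integrable (hg.cont_scale ht))]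
      simp only [mul_add]

lemma errM {w : E3 → ℝ} {ω : ℝ → ℝ} (hw : RW w ω) (m : ℕ) {f : E3 → ℝ}
    (hf : ∀ ε > 0, ∃ δ > 0, ∀ z : E3, z ≠ 0 → ‖z‖ < δ → |f z| ≤ ε * ‖z‖ ^ m) :
    Tendsto (fun t : ℝ => (t ^ m)⁻¹ * ∫ z, w z * f (t • z)) (𝓝[>] 0) (𝓝 0) := by
  have iw : Integrable (fun z => |w z|) := by
    have := hw.integrable (f := fun _ => 1) continuousOn_const
    simpa using this.abs
  set I := ∫ z, |w z| with hI
  have I0 : 0 ≤ I := integral_nonneg fun z => abs_nonneg _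
  rw [Metric.tendsto_nhdsWithin_nhds]
  intro η hη
  obtain ⟨δ, hδ, H⟩ := hf (η / 2 / (2 ^ m * (I + 1))) (by positivity)
  refine ⟨δ / 2, by positivity, fun {t} ht htd => ?_⟩
  have ht0 : 0 < t := ht
  rw [Real.dist_eq, sub_zero, abs_of_pos ht0] at htd
  have h1 : ‖∫ z, w z * f (t • z)‖ ≤ ∫ z, (η / 2 / (2 ^ m * (I + 1)) * (t ^ m * 2 ^ m)) * |w z| := by
    refine norm_integral_le_of_norm_le (iw.const_mul _) (Eventually.of_forall fun z => ?_)
    by_cases hz : z ∈ ann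
    · have e1 : ‖t • z‖ = t * ‖z‖ := by rw [norm_smul, Real.norm_of_nonneg ht0.le]
      have h2 := H (t • z) (smul_ne_zero ht0.ne' (ne_zero_of_ann hz)) (by
        rw [e1]; nlinarith [hz.2, hz.1])
      rw [Real.norm_eq_abs, abs_mul, mul_comm]
      refine mul_le_mul_of_nonneg_right (h2.trans ?_) (abs_nonneg _)
      rw [e1, mul_pow]
      have := hz.2
      gcongr
    · simp [hw.zero z hz]
  rw [integral_const_mul, ← hI] at h1
  rw [Real.dist_eq, sub_zero, abs_mul, abs_of_pos (by positivity : 0 < (t ^ m)⁻¹)]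
  rw [Real.norm_eq_abs] at h1
  calc (t ^ m)⁻¹ * |∫ z, w z * f (t • z)| ≤
      (t ^ m)⁻¹ * (η / 2 / (2 ^ m * (I + 1)) * (t ^ m * 2 ^ m) * I) := by gcongr
    _ = η / 2 * (I / (I + 1)) := by field_simp
    _ ≤ η / 2 * 1 := by
      gcongr
      rw [div_le_one (by positivity)]; linarith
    _ < η := by linarith

lemma rw_th {β : ℝ → ℝ} (hb : Cut β) : RW (th β) (fun t => t ^ 2 * β (t ^ 2)) where
  cont := by
    have := hb.smooth.continuous
    unfold th; fun_prop
  rad _ := rfl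
  zero z hz := by simp [th, hb.zero hz]

lemma rw_ww {β : ℝ → ℝ} (hb : Cut β) :
    RW (ww β) (fun t => 5 * β (t ^ 2) + 2 * t ^ 2 * deriv β (t ^ 2)) where
  cont := by
    have := hb.smooth.continuous
    have h2 : Continuous (deriv β) := hb.smooth.continuous_deriv (by simp)
    unfold ww; fun_prop
  rad _ := rfl
  zero z hz := by simp [ww, hb.zero hz, hb.dzero hz]

lemma Cut.far {β : ℝ → ℝ} (hb : Cut β) {t : ℝ} (ht : t ∉ Set.Icc (3/2 : ℝ) (7/2)) : β t = 0 :=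
  image_eq_zero_of_notMem_tsupport (fun h' => ht (hb.supp h'))

lemma Cut.dfar {β : ℝ → ℝ} (hb : Cut β) {t : ℝ} (ht : t ∉ Set.Icc (3/2 : ℝ) (7/2)) :
    deriv β t = 0 := by
  by_contra h'
  exact ht (hb.supp (support_deriv_subset h'))

lemma vanish {β : ℝ → ℝ} (hb : Cut β) :
    ∫ t in Set.Ioi (0 : ℝ), t ^ 2 * ((5 * β (t ^ 2) + 2 * t ^ 2 * deriv β (t ^ 2)) * t ^ (2 : ℝ))
      = 0 := by
  have hc := hb.smooth.continuous
  have hc2 : Continuous (deriv β) := hb.smooth.continuous_deriv (by simp)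
  have hd : ∀ x ∈ Set.Ici (0 : ℝ), HasDerivAt (fun t : ℝ => t ^ 5 * β (t ^ 2))
      (x ^ 2 * ((5 * β (x ^ 2) + 2 * x ^ 2 * deriv β (x ^ 2)) * x ^ (2 : ℝ))) x := by
    intro x _
    have h1 : HasDerivAt β (deriv β (x ^ 2)) (x ^ 2) :=
      ((hb.smooth.differentiable (by simp)) _).hasDerivAt
    have h3 : HasDerivAt (fun t : ℝ => β (t ^ 2)) (deriv β (x ^ 2) * ((2 : ℕ) * x ^ (2 - 1))) x :=
      HasDerivAt.comp (h₂ := β) (h := fun t : ℝ => t ^ 2) x h1 (hasDerivAt_pow 2 x)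
    have h2 := (hasDerivAt_pow 5 x).mul h3
    refine h2.congr_deriv ?_
    rw [Real.rpow_two]
    push_cast
    ring
  have far : ∀ t : ℝ, t ∉ Set.Icc (0 : ℝ) 2 → 0 < t → t ^ 2 ∉ Set.Icc (3/2 : ℝ) (7/2) := by
    intro t ht h0 h
    refine ht ⟨h0.le, ?_⟩
    nlinarith [h.2]
  have hi : IntegrableOn (fun x : ℝ =>
      x ^ 2 * ((5 * β (x ^ 2) + 2 * x ^ 2 * deriv β (x ^ 2)) * x ^ (2 : ℝ))) (Set.Ioi 0) := by
    have hcont : Continuous (fun x : ℝ =>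
      x ^ 2 * ((5 * β (x ^ 2) + 2 * x ^ 2 * deriv β (x ^ 2)) * x ^ (2 : ℝ))) := by
      simp only [Real.rpow_two]
      fun_prop
    have h1 : IntegrableOn (fun x : ℝ =>
      x ^ 2 * ((5 * β (x ^ 2) + 2 * x ^ 2 * deriv β (x ^ 2)) * x ^ (2 : ℝ))) (Set.Icc 0 2) :=
      hcont.continuousOn.integrableOn_compact isCompact_Icc
    refine h1.of_forall_sdiff_eq_zero measurableSet_Ioi ?_
    intro t ht
    have := far t ht.2 ht.1
    simp [hb.far this, hb.dfar this]
  have hl : Tendsto (fun t : ℝ => t ^ 5 * β (t ^ 2)) atTop (𝓝 0) := by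
    refine tendsto_const_nhds.congr' ?_
    filter_upwards [eventually_gt_atTop 2] with t ht
    rw [hb.far (far t (fun h => by linarith [h.2]) (by linarith)), mul_zero]
  rw [integral_Ioi_of_hasDerivAt_of_tendsto' hd hi hl]
  simp

lemma Cpos {β : ℝ → ℝ} (hb : Cut β) :
    0 < ∫ t in Set.Ioi (0 : ℝ), t ^ 2 * (t ^ 2 * β (t ^ 2)) := by
  have hc := hb.smooth.continuous
  have hcont : Continuous (fun t : ℝ => t ^ 2 * (t ^ 2 * β (t ^ 2))) := by fun_prop
  have hnn : ∀ t : ℝ, 0 ≤ t ^ 2 * (t ^ 2 * β (t ^ 2)) := fun t => by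
    have := hb.nonneg (t ^ 2)
    positivity
  have hi : IntegrableOn (fun t : ℝ => t ^ 2 * (t ^ 2 * β (t ^ 2))) (Set.Ioi 0) := by
    have h1 : IntegrableOn (fun t : ℝ => t ^ 2 * (t ^ 2 * β (t ^ 2))) (Set.Icc 0 2) :=
      hcont.continuousOn.integrableOn_compact isCompact_Icc
    refine h1.of_forall_sdiff_eq_zero measurableSet_Ioi ?_
    intro t ht
    have : t ^ 2 ∉ Set.Icc (3/2 : ℝ) (7/2) := by
      intro h
      have h0 : 0 < t := ht.1
      exact ht.2 ⟨h0.le, by nlinarith [h.2]⟩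
    simp [hb.far this]
  rw [integral_pos_iff_support_of_nonneg_ae (Eventually.of_forall hnn) hi]
  have hs : (0 : ℝ) < Real.sqrt (5/2) := by positivity
  have ho : IsOpen (Function.support (fun t : ℝ => t ^ 2 * (t ^ 2 * β (t ^ 2))) ∩ Set.Ioi 0) :=
    (hcont.isOpen_support).inter isOpen_Ioi
  rw [Measure.restrict_apply' measurableSet_Ioi]
  refine ho.measure_pos _ ⟨Real.sqrt (5/2), ?_, hs⟩
  rw [Function.mem_support, Real.sq_sqrt (by norm_num), hb.one]
  norm_num

lemma pder_scale (F : E3 → ℝ) (t : ℝ) (i : Fin 3) :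
    pder i (fun z => F (t • z)) = fun z => t * pder i F (t • z) := by
  funext z
  unfold pder
  rw [fderiv_comp_smul]
  simp

lemma pder_const_mul (F : E3 → ℝ) (t : ℝ) (i : Fin 3) :
    pder i (fun z => t * F z) = fun z => t * pder i F z := by
  funext z
  unfold pder
  have h1 : (fun z => t * F z) = t • F := by
    funext z
    simp
  rw [h1, fderiv_const_smul_field]
  simp

lemma lapl_scale (F : E3 → ℝ) (t : ℝ) (z : E3) :
    lapl (fun z => F (t • z)) z = t ^ 2 * lapl F (t • z) := by
  unfold lapl
  rw [Finset.mul_sum]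
  refine Finset.sum_congr rfl fun i _ => ?_
  rw [pder_scale, pder_const_mul, pder_scale]
  ring

lemma HH_scale (F G : E3 → ℝ) {t : ℝ} (ht : 0 < t) (z : E3) :
    HH (fun z => F (t • z)) (fun z => G (t • z)) z = t ^ 2 * HH F G (t • z) := by
  unfold HH
  simp only [lapl_scale, pder_scale, Fin.sum_univ_three, norm_smul, Real.norm_of_nonneg ht.le]
  by_cases hz : ‖z‖ = 0
  · simp [hz]; ring
  · simp only [PiLp.smul_apply, smul_eq_mul]
    field_simp

lemma KK_scale (F G : E3 → ℝ) (t : ℝ) (z : E3) :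
    KK (fun z => F (t • z)) (fun z => G (t • z)) z = KK F G (t • z) := by
  unfold KK
  simp only [pder_scale, Fin.sum_univ_three, PiLp.smul_apply, smul_eq_mul]
  ring

lemma cont_HH {F G : E3 → ℝ} {R : ℝ} (hF : ContDiffOn ℝ (⊤ : ℕ∞) F (pun R))
    (hG : ContDiffOn ℝ (⊤ : ℕ∞) G (pun R)) : ContinuousOn (HH F G) (pun R) := by
  have hpF := fun i => contDiffOn_pder (isOpen_pun R) hF i
  have hpG := fun i => contDiffOn_pder (isOpen_pun R) hG i
  have hppF := fun i => (contDiffOn_pder (isOpen_pun R) (hpF i) i).continuousOn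
  have hppG := fun i => (contDiffOn_pder (isOpen_pun R) (hpG i) i).continuousOn
  have hlF : ContinuousOn (lapl F) (pun R) := continuousOn_finsetSum _ fun i _ => hppF i
  have hlG : ContinuousOn (lapl G) (pun R) := continuousOn_finsetSum _ fun i _ => hppG i
  have hn : ContinuousOn (fun z : E3 => ‖z‖ ^ 2) (pun R) := by fun_prop
  have hn0 : ∀ z ∈ pun R, ‖z‖ ^ 2 ≠ 0 := fun z hz => (pow_pos hz.1 2).ne'
  have hs : ContinuousOn (fun z => ∑ i : Fin 3, z i * pder i F z) (pun R) :=
    continuousOn_finsetSum _ fun i _ =>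
      ((EuclideanSpace.proj i : E3 →L[ℝ] ℝ).continuous.continuousOn).mul (hpF i).continuousOn
  exact (hF.continuousOn.mul hlG).sub (((hlF.sub ((continuousOn_const.mul hs).div hn hn0)).add
    ((continuousOn_const.mul hF.continuousOn).div hn hn0)).mul hG.continuousOn)

lemma cont_KK {F G : E3 → ℝ} {R : ℝ} (hF : ContDiffOn ℝ (⊤ : ℕ∞) F (pun R))
    (hG : ContDiffOn ℝ (⊤ : ℕ∞) G (pun R)) : ContinuousOn (KK F G) (pun R) := by
  have hpF := fun i => (contDiffOn_pder (isOpen_pun R) hF i).continuousOn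
  have hpG := fun i => (contDiffOn_pder (isOpen_pun R) hG i).continuousOn
  have hs : ContinuousOn (fun z => ∑ i : Fin 3, z i * (F z * pder i G z - G z * pder i F z))
      (pun R) :=
    continuousOn_finsetSum _ fun i _ =>
      ((EuclideanSpace.proj i : E3 →L[ℝ] ℝ).continuous.continuousOn).mul
        ((hF.continuousOn.mul (hpG i)).sub (hG.continuousOn.mul (hpF i)))
  exact hs.add (continuousOn_const.mul (hF.continuousOn.mul hG.continuousOn))

lemma lsum_shift (l : List (ℝ × ℝ)) {t : ℝ} (ht : 0 < t) :
    lsum (l.map fun p => (p.1 - 2, p.2)) t = (t ^ 2)⁻¹ * lsum l t := by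
  induction l with
  | nil => simp [lsum]
  | cons p l ih =>
    simp only [lsum, List.map_cons, List.sum_cons] at ih ⊢
    rw [ih, Real.rpow_sub ht, Real.rpow_two]
    field_simp

lemma core {F G : E3 → ℝ} {R : ℝ} (hR : 0 < R) (hF : ContDiffOn ℝ (⊤ : ℕ∞) F (pun R))
    (hG : ContDiffOn ℝ (⊤ : ℕ∞) G (pun R)) (eF : Ex F) (eG : Ex G)
    (epF : ∀ i, Ex (pder i F)) (epG : ∀ i, Ex (pder i G)) {L : ℝ} (h : PfLim (HH F G) L) :
    L = 0 := by
  obtain ⟨β, hb⟩ := exists_cut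
  obtain ⟨g, c0, hg, hc, hL, H⟩ := h
  obtain ⟨k, hk, C, hC, δ, hδ, HK⟩ := eF.KK eG epF epG 3
  obtain ⟨l1, n1, e1⟩ := M_PS hg (rw_th hb) 0 (fun h => absurd rfl h)
  obtain ⟨l2, n2, e2⟩ := M_PS hk (rw_ww hb) 2 (fun _ => vanish hb)
  have t1 := errM (rw_th hb) 0 (f := fun z => HH F G z - g z - c0 (‖z‖⁻¹ • z))
    (by simpa using H)
  have t2 := errM (rw_ww hb) 2 (f := fun z => KK F G z - k z) (by
    intro ε hε
    refine ⟨min δ (ε / (C + 1)), by positivity, fun z hz hz' => ?_⟩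
    have h1 := HK z hz (hz'.trans_le (min_le_left _ _))
    have h2 : ‖z‖ < ε / (C + 1) := hz'.trans_le (min_le_right _ _)
    rw [lt_div_iff₀ (by positivity)] at h2
    refine h1.trans ?_
    have : C * ‖z‖ ≤ ε := by nlinarith [norm_nonneg z]
    calc C * ‖z‖ ^ 3 = (C * ‖z‖) * ‖z‖ ^ 2 := by ring
      _ ≤ _ := by gcongr)
  set I := ∫ t in Set.Ioi (0 : ℝ), t ^ 2 * (t ^ 2 * β (t ^ 2)) with hI
  have hI0 : 0 < I := Cpos hb
  have hth : ∫ z, th β z * c0 (‖z‖⁻¹ • z) = I * L := by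
    rw [hL, hI, ← polar (fun t => t ^ 2 * β (t ^ 2)) c0]
    rfl
  have t3 := t1.add t2
  rw [add_zero] at t3
  have t4 : Tendsto (lsum (l1 ++ l2.map fun p => (p.1 - 2, p.2))) (𝓝[>] 0) (𝓝 (-(I * L))) := by
    have t5 : Tendsto (fun t : ℝ => -(I * L) - (((t ^ 0)⁻¹ * ∫ z, th β z *
        (HH F G (t • z) - g (t • z) - c0 (‖t • z‖⁻¹ • t • z))) +
        (t ^ 2)⁻¹ * ∫ z, ww β z * (KK F G (t • z) - k (t • z)))) (𝓝[>] 0) (𝓝 (-(I * L))) := by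
      have := t3.const_sub (-(I * L))
      rwa [sub_zero] at this
    refine t5.congr' ?_
    have hR3 : 0 < R / 3 := by positivity
    filter_upwards [Ioo_mem_nhdsGT hR3] with t ht
    obtain ⟨ht0, htR⟩ := ht
    have mt : Set.MapsTo (fun z : E3 => t • z) (pun 3) (pun R) := by
      intro z hz
      have e1 : ‖t • z‖ = t * ‖z‖ := by rw [norm_smul, Real.norm_of_nonneg ht0.le]
      refine ⟨?_, ?_⟩
      · change 0 < ‖t • z‖
        rw [e1]; exact mul_pos ht0 hz.1
      · change ‖t • z‖ < R
        rw [e1]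
        have h1 := hz.1
        have h2 := hz.2
        nlinarith
    have cs : ContDiff ℝ (⊤ : ℕ∞) (fun z : E3 => t • z) := contDiff_const_smul t
    have hFt : ContDiffOn ℝ (⊤ : ℕ∞) (fun z => F (t • z)) (pun 3) := hF.comp cs.contDiffOn mt
    have hGt : ContDiffOn ℝ (⊤ : ℕ∞) (fun z => G (t • z)) (pun 3) := hG.comp cs.contDiffOn mt
    have main := main_ibp hb hFt hGt
    simp only [HH_scale F G ht0, KK_scale] at main
    have cH : ContinuousOn (fun z => HH F G (t • z)) ann :=
      ((cont_HH hF hG).comp cs.continuous.continuousOn mt).mono ann_subset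
    have cK : ContinuousOn (fun z => KK F G (t • z)) ann :=
      ((cont_KK hF hG).comp cs.continuous.continuousOn mt).mono ann_subset
    have cc : ContinuousOn (fun z : E3 => c0 (‖z‖⁻¹ • z)) ann :=
      (hc.comp_continuousOn cont_dir).mono (fun z hz => ne_zero_of_ann hz)
    have iH := (rw_th hb).integrable cH
    have iK := (rw_ww hb).integrable cK
    have ig := (rw_th hb).integrable (hg.cont_scale ht0)
    have ik := (rw_ww hb).integrable (hk.cont_scale ht0)
    have ic := (rw_th hb).integrable cc
    have edir : ∀ z : E3, ‖t • z‖⁻¹ • t • z = ‖z‖⁻¹ • z := fun z => by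
      rw [norm_smul, Real.norm_of_nonneg ht0.le, smul_smul, mul_inv, mul_right_comm,
        inv_mul_cancel₀ ht0.ne', one_mul]
    have m1 : t ^ 2 * (∫ z, th β z * HH F G (t • z)) + ∫ z, ww β z * KK F G (t • z) = 0 := by
      rw [← main, ← integral_const_mul, ← integral_add (iH.const_mul _) iK]
      congr 1
      funext z
      ring
    have m2 : ∫ z, th β z * (HH F G (t • z) - g (t • z) - c0 (‖t • z‖⁻¹ • t • z)) =
        (∫ z, th β z * HH F G (t • z)) - lsum l1 t - I * L := by
      have iHg : Integrable (fun z => th β z * HH F G (t • z) - th β z * g (t • z)) := iH.sub ig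
      rw [← e1 t ht0, ← hth, ← integral_sub iH ig, ← integral_sub iHg ic]
      congr 1
      funext z
      simp only [edir]
      ring
    have m3 : ∫ z, ww β z * (KK F G (t • z) - k (t • z)) =
        (∫ z, ww β z * KK F G (t • z)) - lsum l2 t := by
      rw [← e2 t ht0, ← integral_sub iK ik]
      congr 1
      funext z
      ring
    rw [m2, m3, lsum_append, lsum_shift l2 ht0]
    have m4 : ∫ z, ww β z * KK F G (t • z) = - (t ^ 2 * (∫ z, th β z * HH F G (t • z))) := by
      linarith
    rw [m4]
    field_simp
    ring
  have := lsum_unique _ _ _ rfl (by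
    intro p hp
    rcases List.mem_append.mp hp with h | h
    · exact n1 p h
    · obtain ⟨q, hq, rfl⟩ := List.mem_map.mp h
      have := n2 q hq
      intro h0
      exact this (by simpa [sub_eq_zero] using h0)) t4
  have h0 : I * L = 0 := by linarith
  rcases mul_eq_zero.mp h0 with h | h
  · exact absurd h hI0.ne'
  · exact h

lemma pder_shift (F : E3 → ℝ) (y : E3) (i : Fin 3) :
    pder i (fun z => F (y + z)) = fun z => pder i F (y + z) := by
  funext z
  unfold pder
  rw [fderiv_comp_add_left]

lemma lapl_shift (F : E3 → ℝ) (y z : E3) : lapl (fun z => F (y + z)) z = lapl F (y + z) := by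
  unfold lapl
  simp only [pder_shift]

lemma sing_shift {F : E3 → ℝ} {y : E3} {c : ℝ → S2 → ℝ} (h : HasSingExpansion y F c) :
    HasSingExpansion 0 (fun z => F (y + z)) c where
  smooth_coeffs := h.smooth_coeffs
  bddBelow := h.bddBelow
  finite_exponents := h.finite_exponents
  expansion := by simpa only [zero_add] using h.expansion

lemma smooth_shift {F : E3 → ℝ} {y : E3} (h : SmoothNearPunctured y F) :
    ∃ R > 0, ContDiffOn ℝ (⊤ : ℕ∞) (fun z => F (y + z)) (pun R) := by
  obtain ⟨U, hU, hF⟩ := h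
  obtain ⟨R, hR, hRU⟩ := Metric.mem_nhds_iff.mp hU
  refine ⟨R, hR, ?_⟩
  have cs : ContDiff ℝ (⊤ : ℕ∞) (fun z : E3 => y + z) := contDiff_const.add contDiff_id
  refine hF.comp cs.contDiffOn ?_
  intro z hz
  refine ⟨hRU (by simpa [Metric.mem_ball, dist_eq_norm] using hz.2), ?_⟩
  have := norm_pos_iff.mp hz.1
  simpa using this

lemma pun_mono {R R' : ℝ} (h : R ≤ R') : pun R ⊆ pun R' := fun _ hz => ⟨hz.1, hz.2.trans_le h⟩

end PfAux

/-- the identity underlying the Laplacian of `Pf(Fδ)`: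
`(F ΔG)_y = ((ΔF − 6 r⁻¹ nⁱ ∂_iF + 6 r⁻² F) G)_y = (r³Δ(r⁻³F) · G)_y`;
in particular `(ΔG)_y = (6 r⁻² G)_y` and `(r² ΔG)_y = 0`. -/
theorem pf_F_times_laplacian_identity
    (y : E3) (F G : E3 → ℝ)
    (hF : SmoothNearPunctured y F) (hG : SmoothNearPunctured y G)
    (cF cG : ℝ → S2 → ℝ)
    (hcF : HasSingExpansion y F cF) (hcG : HasSingExpansion y G cG)
    (hdF : ∀ i : Fin 3, ∃ e, HasSingExpansion y (pder i F) e)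
    (hdG : ∀ i : Fin 3, ∃ e, HasSingExpansion y (pder i G) e)
    (hddF : ∀ i j : Fin 3, ∃ e, HasSingExpansion y (pder i (pder j F)) e)
    (hddG : ∀ i j : Fin 3, ∃ e, HasSingExpansion y (pder i (pder j G)) e) :
    (∀ p q : ℝ → S2 → ℝ,
        HasSingExpansion y (fun x => F x * lapl G x) p →
        HasSingExpansion y
          (fun x => (lapl F x
              - 6 * (∑ i : Fin 3, (x - y) i * pder i F x) / ‖x - y‖ ^ 2
              + 6 * F x / ‖x - y‖ ^ 2) * G x) q →
        pfAt p = pfAt q)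
    ∧ (∀ p : ℝ → S2 → ℝ, HasSingExpansion y (lapl G) p →
        pfAt p = (4 * π)⁻¹ * ∫ n : S2, 6 * cG 2 n ∂dOmega)
    ∧ (∀ p : ℝ → S2 → ℝ,
        HasSingExpansion y (fun x => ‖x - y‖ ^ 2 * lapl G x) p →
        pfAt p = 0) := by
  obtain ⟨R, hR, sG⟩ := PfAux.smooth_shift hG
  obtain ⟨R', hR', sF⟩ := PfAux.smooth_shift hF
  have eG := PfAux.Ex.of_sing (PfAux.sing_shift hcG)
  have eF := PfAux.Ex.of_sing (PfAux.sing_shift hcF)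
  have epG : ∀ i, PfAux.Ex (pder i (fun z => G (y + z))) := fun i => by
    obtain ⟨e, he⟩ := hdG i
    rw [PfAux.pder_shift]
    exact PfAux.Ex.of_sing (PfAux.sing_shift he)
  have epF : ∀ i, PfAux.Ex (pder i (fun z => F (y + z))) := fun i => by
    obtain ⟨e, he⟩ := hdF i
    rw [PfAux.pder_shift]
    exact PfAux.Ex.of_sing (PfAux.sing_shift he)
  refine ⟨?_, ?_, ?_⟩
  · intro p q hp hq
    have lp := PfAux.PfLim.of_sing (PfAux.sing_shift hp) 0
    have lq := PfAux.PfLim.of_sing (PfAux.sing_shift hq) 0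
    have := PfAux.core (lt_min hR hR') (sF.mono (PfAux.pun_mono (min_le_right _ _)))
      (sG.mono (PfAux.pun_mono (min_le_left _ _))) eF eG epF epG
      ((lp.add_mul lq (-1)).congr (fun z _ => by
        simp only [PfAux.HH, PfAux.lapl_shift, PfAux.pder_shift, pow_zero, div_one,
          add_sub_cancel_left]
        ring))
    unfold pfAt
    simp only [Nat.cast_zero] at this
    congr 1
    linarith
  · intro p hp
    have lp := PfAux.PfLim.of_sing (PfAux.sing_shift hp) 0
    have lq := PfAux.PfLim.of_sing (PfAux.sing_shift hcG) 2
    have p1 : ∀ i, pder i (fun _ : E3 => (1 : ℝ)) = fun _ => 0 := fun i => by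
      funext z; simp [pder]
    have p0 : ∀ i, pder i (fun _ : E3 => (0 : ℝ)) = fun _ => 0 := fun i => by
      funext z; simp [pder]
    have := PfAux.core hR (F := fun _ => 1) contDiffOn_const sG (PfAux.Ex.const 1) eG
      (fun i => by rw [p1]; exact PfAux.Ex.const 0) epG
      ((lp.add_mul lq (-6)).congr (fun z _ => by
        have hl : lapl (fun _ : E3 => (1 : ℝ)) z = 0 := by simp [lapl, p1, p0]
        simp only [PfAux.HH, PfAux.lapl_shift, hl, p1, pow_zero, div_one]
        simp
        ring))
    unfold pfAt
    simp only [Nat.cast_zero, Nat.cast_ofNat] at this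
    congr 1
    rw [integral_const_mul]
    linarith
  · intro p hp
    have lp := PfAux.PfLim.of_sing (PfAux.sing_shift hp) 0
    have p1 : ∀ i, pder i (fun z : E3 => ‖z‖ ^ 2) = fun z => 2 * z i := fun i => by
      funext z; exact PfAux.pder_normsq i z
    have p2 : ∀ i, pder i (fun z : E3 => 2 * z i) = fun _ => 2 := fun i => by
      rw [PfAux.pder_const_mul]
      funext z
      rw [PfAux.pder_coord, mul_one]
    have := PfAux.core hR (F := fun z => ‖z‖ ^ 2) PfAux.contDiff_normsq.contDiffOn sG
      PfAux.Ex.normsq eG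
      (fun i => by rw [p1]; exact (PfAux.Ex.const 2).mul (PfAux.Ex.coord i)) epG
      (lp.congr (fun z hz => by
        have hn : ‖z‖ ^ 2 = z 0 ^ 2 + z 1 ^ 2 + z 2 ^ 2 := by
          rw [EuclideanSpace.norm_sq_eq]; simp [Fin.sum_univ_three]
        have hz0 : ‖z‖ ^ 2 ≠ 0 := by
          have := norm_pos_iff.mpr hz
          positivity
        have hs : ∑ i : Fin 3, z i * (2 * z i) = 2 * ‖z‖ ^ 2 := by
          rw [hn, Fin.sum_univ_three]; ring
        have hl : lapl (fun z : E3 => ‖z‖ ^ 2) z = 6 := by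
          simp only [lapl, p1, p2]
          simp
          norm_num
        simp only [PfAux.HH, PfAux.lapl_shift, hl, p1, hs, pow_zero, div_one, add_sub_cancel_left]
        field_simp
        ring))
    unfold pfAt
    simp only [Nat.cast_zero] at this
    rw [this, mul_zero]

end
end
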